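/- Let G be a 2-connected finite simple graph. Then G has strongly chordal treewidth equal to two if and only if G has no minor isomorphic to K_4 or to S_3. -/

import Mathlib

open SimpleGraph

/-- The cycle graph on `ZMod n` (for `3 ≤ n` this is a cycle of length `n`). -/
def cycGraph (n : ℕ) : SimpleGraph (ZMod n) :=
  SimpleGraph.fromRel (fun x y => x = y + 1)

/-- The set `s` of nodes induces a path in the graph `H`. -/
def IsPathSet {ι : Type} (H : SimpleGraph ι) (s : Set ι) : Prop :=
  (H.induce s).Connected ∧ ∀ x ∈ s, {y | y ∈ s ∧ H.Adj x y}.ncard ≤ 2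

/-- The set `s` of nodes induces a directed path in `H` with respect to the
orientation `o` of the edges of `H`. -/
def IsDirPathSet {ι : Type} (H : SimpleGraph ι) (o : ι → ι → Prop) (s : Set ι) : Prop :=
  IsPathSet H s ∧ (∀ x ∈ s, {y | y ∈ s ∧ o x y}.ncard ≤ 1) ∧
    (∀ x ∈ s, {y | y ∈ s ∧ o y x}.ncard ≤ 1)

/-- A tree decomposition of a finite simple graph `G`. -/
structure TreeDecomp {V : Type} (G : SimpleGraph V) where
  ι : Type
  finι : Finite ι
  tree : SimpleGraph ι
  isTree : tree.IsTree
  bag : ι → Set V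
  bag_cover : ∀ v : V, ∃ x, v ∈ bag x
  bag_edge : ∀ ⦃u v : V⦄, G.Adj u v → ∃ x, u ∈ bag x ∧ v ∈ bag x
  bag_conn : ∀ v : V, (tree.induce {x | v ∈ bag x}).Connected

/-- A spaghetti tree decomposition: for every vertex `v` of `G`, the nodes whose
bags contain `v` induce a path in the tree. -/
structure SpaghettiTD {V : Type} (G : SimpleGraph V) extends TreeDecomp G where
  bag_path : ∀ v : V, IsPathSet tree {x | v ∈ bag x}

/-- A directed spaghetti tree decomposition: the tree edges are oriented, and for
every vertex `v` of `G` the nodes whose bags contain `v` induce a directed path. -/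
structure DirSpaghettiTD {V : Type} (G : SimpleGraph V) extends TreeDecomp G where
  orient : ι → ι → Prop
  orient_iff : ∀ x y : ι, tree.Adj x y ↔ (orient x y ∨ orient y x)
  orient_asymm : ∀ x y : ι, orient x y → ¬ orient y x
  bag_dirpath : ∀ v : V, IsDirPathSet tree orient {x | v ∈ bag x}

/-- A special tree decomposition: the tree is rooted, and for every vertex `v` of
`G` the nodes whose bags contain `v` induce a vertical path, i.e. a directed path
with respect to the orientation of every tree edge towards the root. -/
structure SpecialTD {V : Type} (G : SimpleGraph V) extends TreeDecomp G where
  root : ι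
  bag_vertical : ∀ v : V,
    IsDirPathSet tree (fun x y => tree.Adj x y ∧ tree.dist y root < tree.dist x root)
      {x | v ∈ bag x}

/-- A path decomposition of a finite simple graph `G`. -/
structure PathDecomp {V : Type} (G : SimpleGraph V) where
  m : ℕ
  hm : 0 < m
  bag : Fin m → Set V
  bag_cover : ∀ v : V, ∃ i, v ∈ bag i
  bag_edge : ∀ ⦃u v : V⦄, G.Adj u v → ∃ i, u ∈ bag i ∧ v ∈ bag i
  bag_convex : ∀ (v : V) (i j k : Fin m), i ≤ j → j ≤ k → v ∈ bag i → v ∈ bag k → v ∈ bag j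

/-- Treewidth: minimal width of a tree decomposition. -/
noncomputable def treewidth {V : Type} (G : SimpleGraph V) : ℕ :=
  sInf {k | ∃ td : TreeDecomp G, ∀ x, (td.bag x).ncard ≤ k + 1}

/-- Spaghetti treewidth: minimal width of a spaghetti tree decomposition. -/
noncomputable def sptw {V : Type} (G : SimpleGraph V) : ℕ :=
  sInf {k | ∃ td : SpaghettiTD G, ∀ x, (td.bag x).ncard ≤ k + 1}

/-- Directed spaghetti treewidth: minimal width of a directed spaghetti tree
decomposition. -/
noncomputable def dptw {V : Type} (G : SimpleGraph V) : ℕ :=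
  sInf {k | ∃ td : DirSpaghettiTD G, ∀ x, (td.bag x).ncard ≤ k + 1}

/-- Special treewidth: minimal width of a special tree decomposition. -/
noncomputable def spctw {V : Type} (G : SimpleGraph V) : ℕ :=
  sInf {k | ∃ td : SpecialTD G, ∀ x, (td.bag x).ncard ≤ k + 1}

/-- Pathwidth: minimal width of a path decomposition. -/
noncomputable def pw {V : Type} (G : SimpleGraph V) : ℕ :=
  sInf {k | ∃ pd : PathDecomp G, ∀ i, (pd.bag i).ncard ≤ k + 1}

/-- A graph is chordal iff it has no induced (i.e. chordless) cycle of length at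
least four. -/
def IsChordal {V : Type} (G : SimpleGraph V) : Prop :=
  ∀ (S : Set V) (n : ℕ), 4 ≤ n → ¬ Nonempty ((G.induce S) ≃g cycGraph n)

/-- A graph is strongly chordal if it is chordal and every even cycle of length at
least six has an odd chord: a chord splitting the cycle into two odd paths of
length at least three. -/
def IsStronglyChordal {V : Type} (G : SimpleGraph V) : Prop :=
  IsChordal G ∧ ∀ n : ℕ, 6 ≤ n → Even n → ∀ f : ZMod n → V,
    Function.Injective f → (∀ i : ZMod n, G.Adj (f i) (f (i + 1))) →
      ∃ (i : ZMod n) (d : ℕ), Odd d ∧ 3 ≤ d ∧ d + 3 ≤ n ∧ G.Adj (f i) (f (i + (d : ZMod n)))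

/-- Strongly chordal treewidth: the minimum of `ω(H) - 1` over all strongly chordal
supergraphs `H` of `G` (on the same vertex set; here `ω(H) ≤ k + 1` is expressed as
`H.CliqueFree (k + 2)`). -/
noncomputable def sctw {V : Type} (G : SimpleGraph V) : ℕ :=
  sInf {k | ∃ H : SimpleGraph V, G ≤ H ∧ IsStronglyChordal H ∧ H.CliqueFree (k + 2)}

/-- `H` is a minor of `G`: there is a family of nonempty, pairwise disjoint,
connected branch sets in `G`, one for each vertex of `H`, such that every edge of
`H` is realized by an edge of `G` between the corresponding branch sets. -/
def IsMinorOf {W V : Type} (H : SimpleGraph W) (G : SimpleGraph V) : Prop :=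
  ∃ f : W → Set V,
    (∀ w, (f w).Nonempty) ∧ (∀ w, (G.induce (f w)).Connected) ∧
    (Pairwise fun w w' => Disjoint (f w) (f w')) ∧
    ∀ ⦃w w'⦄, H.Adj w w' → ∃ u ∈ f w, ∃ v ∈ f w', G.Adj u v

/-- The complete graph on four vertices. -/
def K4 : SimpleGraph (Fin 4) := ⊤

/-- `D₃`: two vertices (`0` and `1`) joined by three internally vertex-disjoint
paths of length three. -/
def D3 : SimpleGraph (Fin 8) := SimpleGraph.fromRel (fun x y =>
  (x = 0 ∧ y = 2) ∨ (x = 2 ∧ y = 3) ∨ (x = 3 ∧ y = 1) ∨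
  (x = 0 ∧ y = 4) ∨ (x = 4 ∧ y = 5) ∨ (x = 5 ∧ y = 1) ∨
  (x = 0 ∧ y = 6) ∨ (x = 6 ∧ y = 7) ∨ (x = 7 ∧ y = 1))

/-- `S₃` (the 3-sun): a 6-cycle `0 1 2 3 4 5` together with the triangle `1 3 5`. -/
def S3 : SimpleGraph (Fin 6) := SimpleGraph.fromRel (fun x y =>
  (x = 0 ∧ y = 1) ∨ (x = 1 ∧ y = 2) ∨ (x = 2 ∧ y = 3) ∨ (x = 3 ∧ y = 4) ∨
  (x = 4 ∧ y = 5) ∨ (x = 5 ∧ y = 0) ∨ (x = 1 ∧ y = 3) ∨ (x = 3 ∧ y = 5) ∨ (x = 5 ∧ y = 1))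

/-- A graph is 2-connected if it has at least three vertices and deleting any one
vertex leaves it connected. -/
def TwoConnected {V : Type} (G : SimpleGraph V) : Prop :=
  3 ≤ Nat.card V ∧ ∀ v : V, (G.induce {x | x ≠ v}).Connected

/-- The cell completion of `G`: add an edge `vw` for every pair of (nonadjacent)
vertices `v, w` such that deleting `v` and `w` leaves at least three connected
components. -/
def cellCompletion {V : Type} (G : SimpleGraph V) : SimpleGraph V :=
  SimpleGraph.fromRel (fun v w => G.Adj v w ∨
    3 ≤ Nat.card ((G.induce {x | x ≠ v ∧ x ≠ w}).ConnectedComponent))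

/-- The induced subgraph of `G` on `S` has no cut vertex. -/
def NoCutVertex {V : Type} (G : SimpleGraph V) (S : Set V) : Prop :=
  ∀ v ∈ S, (S \ {v}).Nonempty → (G.induce (S \ {v})).Connected

/-- `S` carries a block of `G`: a maximal connected (induced) subgraph without a
cut vertex. -/
def IsBlock {V : Type} (G : SimpleGraph V) (S : Set V) : Prop :=
  S.Nonempty ∧ (G.induce S).Connected ∧ NoCutVertex G S ∧
    ∀ S' : Set V, S ⊆ S' → (G.induce S').Connected → NoCutVertex G S' → S' = S

/-- Glue a cycle of length `n` onto the graph `G` by identifying the cycle edge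
`{0, 1}` (with its end vertices) with the edge `{a, b}` of `G`. -/
def glueCycle {V : Type} (G : SimpleGraph V) (n : ℕ) (a b : V) :
    SimpleGraph (V ⊕ {x : ZMod n // x ≠ 0 ∧ x ≠ 1}) :=
  SimpleGraph.fromRel (fun p q =>
    match p, q with
    | Sum.inl u, Sum.inl v => G.Adj u v
    | Sum.inl u, Sum.inr x => (u = a ∧ (cycGraph n).Adj 0 x.1) ∨ (u = b ∧ (cycGraph n).Adj 1 x.1)
    | Sum.inr x, Sum.inr y => (cycGraph n).Adj x.1 y.1
    | Sum.inr _, Sum.inl _ => False)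

/-- The class of trees of cycles: every cycle is a tree of cycles, and gluing a
cycle onto a tree of cycles along an edge yields a tree of cycles (up to
isomorphism). -/
inductive IsTreeOfCycles : {V : Type} → SimpleGraph V → Prop
  | cycle {V : Type} (G : SimpleGraph V) (n : ℕ) (hn : 3 ≤ n)
      (e : Nonempty (G ≃g cycGraph n)) : IsTreeOfCycles G
  | glue {V W : Type} (G : SimpleGraph V) (hG : IsTreeOfCycles G)
      (n : ℕ) (hn : 3 ≤ n) (a b : V) (hab : G.Adj a b)
      (H : SimpleGraph W) (e : Nonempty (H ≃g glueCycle G n a b)) : IsTreeOfCycles H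

/-- `S` is the vertex set of a chordless cycle of `G`, i.e. it induces a cycle. -/
def IsChordlessCycle {V : Type} (G : SimpleGraph V) (S : Set V) : Prop :=
  ∃ n : ℕ, 3 ≤ n ∧ Nonempty ((G.induce S) ≃g cycGraph n)

/-- The edge `uv` is an edge separator: it lies in at least two distinct chordless
cycles of `G`. -/
def IsEdgeSeparator {V : Type} (G : SimpleGraph V) (u v : V) : Prop :=
  G.Adj u v ∧ ∃ S₁ S₂ : Set V, S₁ ≠ S₂ ∧ IsChordlessCycle G S₁ ∧ IsChordlessCycle G S₂ ∧
    u ∈ S₁ ∧ v ∈ S₁ ∧ u ∈ S₂ ∧ v ∈ S₂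

/-- `S` is a simplicial triangle of `G`: a chordless cycle on three vertices
containing a simplicial vertex of `G`. -/
def IsSimplicialTriangle {V : Type} (G : SimpleGraph V) (S : Set V) : Prop :=
  IsChordlessCycle G S ∧ S.ncard = 3 ∧ ∃ v ∈ S, G.IsClique (G.neighborSet v)

/-- A chain tree of cycles: a tree of cycles in which every edge lies in at most two
chordless cycles that are not simplicial triangles (equivalently, if an edge lies in
`m ≥ 3` chordless cycles then at least `m - 2` of them are simplicial triangles). -/
def IsChainTreeOfCycles {V : Type} (G : SimpleGraph V) : Prop :=
  IsTreeOfCycles G ∧ ∀ u v : V, G.Adj u v →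
    {S : Set V | IsChordlessCycle G S ∧ u ∈ S ∧ v ∈ S ∧ ¬ IsSimplicialTriangle G S}.ncard ≤ 2

/-- A tree of two-boundaried cycles: a tree of cycles in which every chordless
cycle contains at most two edge separators. -/
def IsTreeOfTwoBoundariedCycles {V : Type} (G : SimpleGraph V) : Prop :=
  IsTreeOfCycles G ∧ ∀ S : Set V, IsChordlessCycle G S →
    {e : Sym2 V | ∃ u v : V, e = s(u, v) ∧ u ∈ S ∧ v ∈ S ∧ IsEdgeSeparator G u v}.ncard ≤ 2

/-- A path of cycles: a tree of cycles in which every chordless cycle contains at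
most two edge separators and every edge lies in at most two chordless cycles that
are not simplicial triangles. -/
def IsPathOfCycles {V : Type} (G : SimpleGraph V) : Prop :=
  IsTreeOfCycles G ∧
    (∀ S : Set V, IsChordlessCycle G S →
      {e : Sym2 V | ∃ u v : V, e = s(u, v) ∧ u ∈ S ∧ v ∈ S ∧ IsEdgeSeparator G u v}.ncard ≤ 2) ∧
    ∀ u v : V, G.Adj u v →
      {S : Set V | IsChordlessCycle G S ∧ u ∈ S ∧ v ∈ S ∧ ¬ IsSimplicialTriangle G S}.ncard ≤ 2

/-- The graph is a single edge. -/
def IsSingleEdgeGraph {V : Type} (G : SimpleGraph V) : Prop :=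
  Nat.card V = 2 ∧ ∀ a b : V, a ≠ b → G.Adj a b

/-- A mamba: a 2-connected graph of pathwidth two, a single edge, or an isolated
vertex. -/
def IsMamba {V : Type} (G : SimpleGraph V) : Prop :=
  (TwoConnected G ∧ pw G = 2) ∨ IsSingleEdgeGraph G ∨ Nat.card V = 1

/-- `v` is a head vertex of the mamba `G`: some path decomposition of `G` of width
at most two has `v` in its first bag. -/
def IsHeadVertex {V : Type} (G : SimpleGraph V) (v : V) : Prop :=
  ∃ pd : PathDecomp G, (∀ i, (pd.bag i).ncard ≤ 3) ∧ v ∈ pd.bag ⟨0, pd.hm⟩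

/-- Glue the graph `M` onto the graph `G` by identifying the vertex `h` of `M` with
the vertex `x` of `G`. -/
def glueAtVertex {V W : Type} (G : SimpleGraph V) (x : V) (M : SimpleGraph W) (h : W) :
    SimpleGraph (V ⊕ {w : W // w ≠ h}) :=
  SimpleGraph.fromRel (fun p q =>
    match p, q with
    | Sum.inl u, Sum.inl u' => G.Adj u u'
    | Sum.inl u, Sum.inr w => u = x ∧ M.Adj h w.1
    | Sum.inr w, Sum.inr w' => M.Adj w.1 w'.1
    | Sum.inr _, Sum.inl _ => False)

/-- The class of mamba trees: every mamba is a mamba tree, and gluing a mamba onto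
a mamba tree by identifying a vertex of the mamba tree with a head vertex of the
mamba yields a mamba tree (up to isomorphism). -/
inductive IsMambaTree : {V : Type} → SimpleGraph V → Prop
  | mamba {V : Type} (G : SimpleGraph V) (hG : IsMamba G) : IsMambaTree G
  | glue {V W U : Type} (G : SimpleGraph V) (hG : IsMambaTree G)
      (M : SimpleGraph W) (hM : IsMamba M) (x : V) (h : W) (hh : IsHeadVertex M h)
      (K : SimpleGraph U) (e : Nonempty (K ≃g glueAtVertex G x M h)) : IsMambaTree K

/-- Subdivide the edge `{a, b}` of `G` by a new vertex. -/
def subdivideEdge {V : Type} (G : SimpleGraph V) (a b : V) : SimpleGraph (V ⊕ Unit) :=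
  SimpleGraph.fromRel (fun p q =>
    match p, q with
    | Sum.inl u, Sum.inl v => G.Adj u v ∧ ¬(u = a ∧ v = b) ∧ ¬(u = b ∧ v = a)
    | Sum.inl u, Sum.inr _ => u = a ∨ u = b
    | Sum.inr _, _ => False)

/-- `H` is a subdivision of `G`: `H` is obtained from (an isomorphic copy of) `G`
by repeatedly subdividing edges. -/
inductive IsSubdivisionOf : {W V : Type} → SimpleGraph W → SimpleGraph V → Prop
  | base {V W : Type} {G : SimpleGraph V} {H : SimpleGraph W}
      (e : Nonempty (H ≃g G)) : IsSubdivisionOf H G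
  | step {V W U : Type} {G : SimpleGraph V} {H : SimpleGraph W} (a b : W) (hab : H.Adj a b)
      (h : IsSubdivisionOf H G) {K : SimpleGraph U}
      (e : Nonempty (K ≃g subdivideEdge H a b)) : IsSubdivisionOf K G

/-- Contract the edge `{a, b}` of `G` (the contracted vertex is `a`, `b` is removed). -/
def contractEdge {V : Type} (G : SimpleGraph V) (a b : V) : SimpleGraph {x : V // x ≠ b} :=
  SimpleGraph.fromRel (fun x y =>
    G.Adj x.1 y.1 ∨ (x.1 = a ∧ G.Adj b y.1) ∨ (y.1 = a ∧ G.Adj b x.1))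

section Connectivity

variable {V : Type} {G H : SimpleGraph V} {A B X : Set V} {v : V}

/-- `A` is nonempty and connected in `G`: every nonempty subset of `A` that is closed under
taking neighbours inside `A` is all of `A`. -/
def ConnectedOn (G : SimpleGraph V) (A : Set V) : Prop :=
  A.Nonempty ∧ ∀ X : Set V, X ⊆ A → X.Nonempty →
    (∀ x ∈ X, ∀ y ∈ A, G.Adj x y → y ∈ X) → A ⊆ X

/-- Some edge of `G` joins `A` to `B`. -/
def Touches (G : SimpleGraph V) (A B : Set V) : Prop :=
  ∃ x ∈ A, ∃ y ∈ B, G.Adj x y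

lemma Touches.symm (h : Touches G A B) : Touches G B A := by
  obtain ⟨x, hx, y, hy, hxy⟩ := h
  exact ⟨y, hy, x, hx, hxy.symm⟩

lemma Touches.mono (hGH : G ≤ H) (h : Touches G A B) : Touches H A B := by
  obtain ⟨x, hx, y, hy, hxy⟩ := h
  exact ⟨x, hx, y, hy, hGH hxy⟩

lemma ConnectedOn.mono (hGH : G ≤ H) (h : ConnectedOn G A) : ConnectedOn H A :=
  ⟨h.1, fun X hX hne hcl => h.2 X hX hne fun x hx y hy hxy => hcl x hx y hy (hGH hxy)⟩

lemma connectedOn_singleton : ConnectedOn G {v} := by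
  refine ⟨⟨v, rfl⟩, ?_⟩
  rintro X hX ⟨x, hx⟩ _ _ rfl
  obtain rfl := hX hx
  exact hx

lemma connectedOn_iff_connected : ConnectedOn G A ↔ (G.induce A).Connected := by
  constructor
  · rintro ⟨⟨a, ha⟩, h⟩
    rw [connected_iff_exists_forall_reachable]
    refine ⟨⟨a, ha⟩, ?_⟩
    have := h {x | ∃ hx : x ∈ A, (G.induce A).Reachable ⟨a, ha⟩ ⟨x, hx⟩}
      (fun x hx => hx.1) ⟨a, ha, Reachable.refl _⟩ (by
        rintro x ⟨hx, hr⟩ y hy hxy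
        exact ⟨hy, hr.trans (Adj.reachable (by simpa using hxy))⟩)
    rintro ⟨w, hw⟩
    exact (this hw).2
  · intro h
    obtain ⟨⟨a, ha⟩⟩ := h.nonempty
    refine ⟨⟨a, ha⟩, ?_⟩
    rintro X hX ⟨x, hx⟩ hcl y hy
    obtain ⟨p⟩ := h.preconnected ⟨x, hX hx⟩ ⟨y, hy⟩
    have key : ∀ (u w : A), (G.induce A).Walk u w → u.1 ∈ X → w.1 ∈ X := by
      intro u w p
      induction p with
      | nil => exact id
      | cons hadj _ ih => exact fun hu => ih (hcl _ hu _ (Subtype.prop _) (by simpa using hadj))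
    exact key _ _ p hx

/-- In a connected set with at least two elements, every element has a neighbour. -/
lemma ConnectedOn.exists_adj (h : ConnectedOn G A) (hv : v ∈ A) (hne : A ≠ {v}) :
    ∃ u ∈ A, G.Adj v u := by
  by_contra! hcon
  apply hne
  refine (h.2 {v} (by simpa) ⟨v, rfl⟩ ?_).antisymm (by simpa)
  rintro x rfl y hy hxy
  exact absurd hxy (hcon y hy)

lemma ConnectedOn.union (hA : ConnectedOn G A) (hB : ConnectedOn G B) (h : Touches G A B) :
    ConnectedOn G (A ∪ B) := by
  obtain ⟨a, ha, b, hb, hab⟩ := h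
  refine ⟨⟨a, Or.inl ha⟩, fun X hX ⟨x, hx⟩ hcl => ?_⟩
  have hAX : a ∈ X → A ⊆ X := fun haX y hy =>
    (hA.2 (X ∩ A) (fun _ h => h.2) ⟨a, haX, ha⟩
      (fun x hx y hy hxy => ⟨hcl x hx.1 y (Or.inl hy) hxy, hy⟩) hy).1
  have hBX : b ∈ X → B ⊆ X := fun hbX y hy =>
    (hB.2 (X ∩ B) (fun _ h => h.2) ⟨b, hbX, hb⟩
      (fun x hx y hy hxy => ⟨hcl x hx.1 y (Or.inr hy) hxy, hy⟩) hy).1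
  have ha' : a ∈ X := by
    rcases hX hx with h | h
    · exact (hA.2 (X ∩ A) (fun _ h => h.2) ⟨x, hx, h⟩
        (fun x hx y hy hxy => ⟨hcl x hx.1 y (Or.inl hy) hxy, hy⟩) ha).1
    · exact hcl b (hB.2 (X ∩ B) (fun _ h => h.2) ⟨x, hx, h⟩
        (fun x hx y hy hxy => ⟨hcl x hx.1 y (Or.inr hy) hxy, hy⟩) hb).1 a (Or.inl ha) hab.symm
  exact Set.union_subset (hAX ha') (hBX (hcl a ha' b (Or.inr hb) hab))

/-- The component of `c` in the subgraph of `G` induced on `A`. -/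
lemma exists_component (G : SimpleGraph V) {c : V} (hc : c ∈ A) :
    ∃ C ⊆ A, c ∈ C ∧ ConnectedOn G C ∧ ∀ x ∈ C, ∀ y ∈ A, G.Adj x y → y ∈ C := by
  let C : Set V := ⋂₀ {X | c ∈ X ∧ ∀ x ∈ X, ∀ y ∈ A, G.Adj x y → y ∈ X}
  have hCcl : ∀ x ∈ C, ∀ y ∈ A, G.Adj x y → y ∈ C := fun x hx y hy hxy X hX =>
    hX.2 x (hx X hX) y hy hxy
  have hcC : c ∈ C := fun X hX => hX.1
  have hCA : C ⊆ A := Set.sInter_subset_of_mem ⟨hc, fun _ _ y hy _ => hy⟩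
  refine ⟨C, hCA, hcC, ⟨⟨c, hcC⟩, fun X hX hne hcl => ?_⟩, hCcl⟩
  have hcX : c ∈ X := by
    by_contra hcX
    obtain ⟨x, hx⟩ := hne
    have := hX hx (C \ X) ⟨⟨hcC, hcX⟩, fun y hy z hz hyz =>
      ⟨hCcl y hy.1 z hz hyz, fun hzX => hy.2 (hcl z hzX y hy.1 hyz.symm)⟩⟩
    exact this.2 hx
  exact Set.sInter_subset_of_mem ⟨hcX, fun x hx y hy hxy => hcl x hx y (hCcl x (hX hx) y hy hxy) hxy⟩

/-- The image of an initial segment of a walk is connected. -/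
lemma connectedOn_image_Icc {p : ℕ → V} {m n : ℕ} (hmn : m ≤ n)
    (hp : ∀ i, m ≤ i → i < n → G.Adj (p i) (p (i + 1))) : ConnectedOn G (p '' Set.Icc m n) := by
  induction n, hmn using Nat.le_induction with
  | base => simpa using connectedOn_singleton
  | succ n hn ih =>
    have : p '' Set.Icc m (n + 1) = p '' Set.Icc m n ∪ {p (n + 1)} := by
      rw [← Set.image_singleton, ← Set.image_union]
      congr 1
      ext x
      simp only [Set.mem_Icc, Set.mem_union, Set.mem_singleton_iff]
      lia
    rw [this]
    exact (ih fun i h1 h2 => hp i h1 (by lia)).union connectedOn_singleton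
      ⟨_, ⟨n, ⟨hn, le_rfl⟩, rfl⟩, _, rfl, hp n hn (by lia)⟩

end Connectivity

section Models

variable {V : Type}

/-- The set of vertices carrying the label `i`. -/
def labelClass {ι : Type} (L : V → Option ι) (i : ι) : Set V := {x | L x = some i}

/-- A model of `K₄` in `G`, presented as a partial labelling of the vertices. -/
def HasCliqueModel (G : SimpleGraph V) : Prop :=
  ∃ L : V → Option (Fin 4), (∀ i, ConnectedOn G (labelClass L i)) ∧
    ∀ i j, i ≠ j → Touches G (labelClass L i) (labelClass L j)

/-- A labelling `L` describing a model of the 3-sun in `G` relative to a graph `M` of marked edges: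
three connected sets (labels `(true, i)`) pairwise joined by edges, such that the two sets other
than the `i`-th one are joined by a marked edge or by a further connected set
(label `(false, i)`). -/
structure IsSunModel (G M : SimpleGraph V) (L : V → Option (Bool × Fin 3)) : Prop where
  conn : ∀ i, ConnectedOn G (labelClass L (true, i))
  touches : ∀ i j, i ≠ j → Touches G (labelClass L (true, i)) (labelClass L (true, j))
  ear : ∀ i, (∀ j k, i ≠ j → i ≠ k → j ≠ k →
        Touches M (labelClass L (true, j)) (labelClass L (true, k))) ∨
      (ConnectedOn G (labelClass L (false, i)) ∧
        ∀ j, i ≠ j → Touches G (labelClass L (false, i)) (labelClass L (true, j)))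

/-- The edge `ab` of a triangle `abc` of `H` is marked or lies in a second triangle. -/
def IsBlocked (H M : SimpleGraph V) (a b c : V) : Prop :=
  M.Adj a b ∨ ∃ d, d ≠ c ∧ H.Adj a d ∧ H.Adj b d

/-- Every nonempty set of vertices has an element that is simplicial in the subgraph induced
on that set. -/
def IsEliminable (H : SimpleGraph V) : Prop :=
  ∀ T : Set V, T.Nonempty → ∃ v ∈ T, ∀ x ∈ T, ∀ y ∈ T, H.Adj v x → H.Adj v y → x ≠ y → H.Adj x y

end Models

section Elimination

variable {V : Type} {G H M : SimpleGraph V} {A B T : Set V} {v : V}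

lemma ConnectedOn.diff_simplicial (h : ConnectedOn G A) (hv : v ∈ A) (hne : A ≠ {v})
    (hs : ∀ x ∈ A, ∀ y ∈ A, G.Adj v x → G.Adj v y → x ≠ y → G.Adj x y) :
    ConnectedOn G (A \ {v}) := by
  obtain ⟨u, hu, hvu⟩ := h.exists_adj hv hne
  refine ⟨⟨u, hu, hvu.ne'⟩, fun X hX ⟨x, hx⟩ hcl => ?_⟩
  by_cases hvX : ∃ w ∈ X, G.Adj v w
  · obtain ⟨w, hw, hvw⟩ := hvX
    have := h.2 (insert v X) (Set.insert_subset hv fun y hy => (hX hy).1) ⟨v, Or.inl rfl⟩ (by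
      rintro y (rfl | hy) z hz hyz
      · by_cases hzw : z = w
        · exact Or.inr (hzw ▸ hw)
        · exact Or.inr (hcl w hw z ⟨hz, hyz.ne'⟩ (hs w (hX hw).1 z hz hvw hyz (Ne.symm hzw)))
      · by_cases hzv : z = v
        · exact Or.inl hzv
        · exact Or.inr (hcl y hy z ⟨hz, hzv⟩ hyz))
    exact fun y hy => (this hy.1).resolve_left hy.2
  · push Not at hvX
    have := h.2 X (fun y hy => (hX hy).1) ⟨x, hx⟩ (fun y hy z hz hyz =>
      hcl y hy z ⟨hz, fun hzv => hvX y hy ((show z = v from hzv) ▸ hyz.symm)⟩ hyz)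
    exact fun y hy => this hy.1

lemma Touches.diff_simplicial (h : Touches G A B) (hA : ConnectedOn G A) (hv : v ∈ A)
    (hne : A ≠ {v}) (hd : Disjoint A B)
    (hs : ∀ x ∈ A, ∀ y ∈ B, G.Adj v x → G.Adj v y → x ≠ y → G.Adj x y) :
    Touches G (A \ {v}) B := by
  obtain ⟨x, hx, y, hy, hxy⟩ := h
  by_cases hxv : x = v
  · subst hxv
    obtain ⟨u, hu, hvu⟩ := hA.exists_adj hv hne
    exact ⟨u, ⟨hu, hvu.ne'⟩, y, hy, hs u hu y hy hvu hxy (hd.ne_of_mem hu hy)⟩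
  · exact ⟨x, ⟨hx, hxv⟩, y, hy, hxy⟩

/-- In an eliminable graph, an edge whose ends are connected without using that edge inside a
set of vertices lies in a triangle within that set. -/
lemma IsEliminable.exists_common_neighbor [Finite V] (hH : IsEliminable H) {b c : V}
    (hbc : H.Adj b c) (hb : b ∈ T) (hc : c ∈ T)
    (hT : ConnectedOn (H.deleteEdges {s(b, c)}) T) : ∃ d ∈ T, H.Adj b d ∧ H.Adj c d := by
  induction T using WellFoundedLT.induction with
  | ind T ih =>
  obtain ⟨v, hv, hs⟩ := hH T ⟨b, hb⟩
  have hne : T ≠ {v} := fun h => hbc.ne (by rw [h] at hb hc; rw [hb, hc])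
  obtain ⟨u, hu, hvu⟩ := hT.exists_adj hv hne
  rw [deleteEdges_adj] at hvu
  by_cases hvb : v = b
  · subst hvb
    exact ⟨u, hu, hvu.1, hs c hc u hu hbc hvu.1 fun h => hvu.2 (by simp [h])⟩
  by_cases hvc : v = c
  · subst hvc
    exact ⟨u, hu, hs b hb u hu hbc.symm hvu.1 fun h => hvu.2 (by simp [h, Sym2.eq_swap]), hvu.1⟩
  by_cases hboth : H.Adj v b ∧ H.Adj v c
  · exact ⟨v, hv, hboth.1.symm, hboth.2.symm⟩
  obtain ⟨d, hd, h⟩ := ih (T \ {v}) ⟨Set.sdiff_subset, fun h => (h hv).2 rfl⟩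
    ⟨hb, Ne.symm hvb⟩ ⟨hc, Ne.symm hvc⟩ (hT.diff_simplicial hv hne (by
      intro x hx y hy hvx hvy hxy
      rw [deleteEdges_adj] at hvx hvy ⊢
      refine ⟨hs x hx y hy hvx.1 hvy.1 hxy, fun h => hboth ?_⟩
      rcases Sym2.eq_iff.1 h with ⟨rfl, rfl⟩ | ⟨rfl, rfl⟩
      · exact ⟨hvx.1, hvy.1⟩
      · exact ⟨hvy.1, hvx.1⟩))
  exact ⟨d, hd.1, h⟩

open Classical in
lemma labelClass_update_none {ι : Type} (L : V → Option ι) (v : V) (i : ι) :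
    labelClass (Function.update L v none) i = labelClass L i \ {v} := by
  ext x
  by_cases h : x = v <;> simp [labelClass, h]

lemma disjoint_labelClass {ι : Type} (L : V → Option ι) {i j : ι} (h : i ≠ j) :
    Disjoint (labelClass L i) (labelClass L j) := by
  rw [Set.disjoint_left]
  intro x hx hy
  exact h (Option.some_injective _ (hx.symm.trans hy))

lemma Touches.diff_diff_simplicial {ι : Type} {L : V → Option ι} {i j : ι}
    (h : Touches G (labelClass L i) (labelClass L j)) (hij : i ≠ j)
    (hi : v ∈ labelClass L i → ConnectedOn G (labelClass L i) ∧ labelClass L i ≠ {v})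
    (hj : v ∈ labelClass L j → ConnectedOn G (labelClass L j) ∧ labelClass L j ≠ {v})
    (hs : ∀ x, L x ≠ none → ∀ y, L y ≠ none → G.Adj v x → G.Adj v y → x ≠ y → G.Adj x y) :
    Touches G (labelClass L i \ {v}) (labelClass L j \ {v}) := by
  have hL : ∀ {k x}, x ∈ labelClass L k → L x ≠ none := fun {k x} hx => by
    rw [show L x = some k from hx]; simp
  by_cases hvi : v ∈ labelClass L i
  · rw [Set.sdiff_singleton_eq_self (Set.disjoint_left.1 (disjoint_labelClass L hij) hvi)]
    exact h.diff_simplicial (hi hvi).1 hvi (hi hvi).2 (disjoint_labelClass L hij)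
      fun x hx y hy => hs x (hL hx) y (hL hy)
  by_cases hvj : v ∈ labelClass L j
  · rw [Set.sdiff_singleton_eq_self hvi]
    exact (h.symm.diff_simplicial (hj hvj).1 hvj (hj hvj).2 (disjoint_labelClass L hij.symm)
      fun x hx y hy => hs x (hL hx) y (hL hy)).symm
  rwa [Set.sdiff_singleton_eq_self hvi, Set.sdiff_singleton_eq_self hvj]

open Classical in
/-- A model of `K₄` in an eliminable graph yields a clique on four vertices. -/
lemma IsEliminable.not_hasCliqueModel [Finite V] (hH : IsEliminable H) (hfree : H.CliqueFree 4) :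
    ¬ HasCliqueModel H := by
  rintro ⟨L, hconn, htouch⟩
  induction hT : {x | L x ≠ none} using WellFoundedLT.induction generalizing L with
  | ind T ih =>
  subst hT
  have hL : ∀ {k x}, x ∈ labelClass L k → L x ≠ none := fun {k x} hx => by
    rw [show L x = some k from hx]; simp
  obtain ⟨v, hv, hs⟩ := hH {x | L x ≠ none} ((hconn 0).1.mono fun x hx => hL hx)
  obtain ⟨i, hi⟩ := Option.ne_none_iff_exists'.1 hv
  have hvi : ∀ j, v ∈ labelClass L j → j = i := fun j hj =>
    Option.some_injective _ (hj.symm.trans hi)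
  by_cases hsing : labelClass L i = {v}
  · have hex : ∀ j, j ≠ i → ∃ x ∈ labelClass L j, H.Adj v x := by
      intro j hj
      obtain ⟨x, hx, y, hy, hxy⟩ := htouch i j hj.symm
      rw [hsing] at hx
      exact ⟨y, hy, hx ▸ hxy⟩
    have : Nonempty V := ⟨v⟩
    choose! f hf hvf using hex
    let g : Fin 4 → V := fun j => if j = i then v else f j
    have hg : ∀ j k, j ≠ k → H.Adj (g j) (g k) := by
      intro j k hjk
      by_cases hj : j = i
      · subst hj
        simpa [g, hjk.symm] using hvf k hjk.symm
      by_cases hk : k = i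
      · subst hk
        simpa [g, hj] using (hvf j hj).symm
      simpa [g, hj, hk] using hs _ (hL (hf j hj)) _ (hL (hf k hk)) (hvf j hj) (hvf k hk)
        ((disjoint_labelClass L hjk).ne_of_mem (hf j hj) (hf k hk))
    have hinj : Function.Injective g := fun j k h => by
      by_contra hjk
      exact (hg j k hjk).ne h
    refine hfree (Finset.univ.map ⟨g, hinj⟩) ⟨?_, by simp⟩
    intro x hx y hy hxy
    simp only [Finset.coe_map, Function.Embedding.coeFn_mk, Finset.coe_univ, Set.image_univ,
      Set.mem_range] at hx hy
    obtain ⟨j, rfl⟩ := hx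
    obtain ⟨k, rfl⟩ := hy
    exact hg j k fun h => hxy (h ▸ rfl)
  · have hns : ∀ j, v ∈ labelClass L j → labelClass L j ≠ {v} := fun j hj => hvi j hj ▸ hsing
    refine ih {x | Function.update L v none x ≠ none} ?_ (Function.update L v none) ?_ ?_ rfl
    · refine ⟨fun x hx => ?_, fun h => ?_⟩
      · by_cases hxv : x = v
        · simp [hxv] at hx
        · simpa [hxv] using hx
      · simpa using h hv
    · intro j
      rw [labelClass_update_none]
      by_cases hvj : v ∈ labelClass L j
      · exact (hconn j).diff_simplicial hvj (hns j hvj) fun x hx y hy => hs x (hL hx) y (hL hy)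
      · rw [Set.sdiff_singleton_eq_self hvj]
        exact hconn j
    · intro j k hjk
      rw [labelClass_update_none, labelClass_update_none]
      exact (htouch j k hjk).diff_diff_simplicial hjk (fun h => ⟨hconn j, hns j h⟩)
        (fun h => ⟨hconn k, hns k h⟩) hs

end Elimination

section BlockedTriangle

variable {V : Type} {G H M : SimpleGraph V} {A B T : Set V} {v : V}

lemma not_adj_of_cliqueFree_four (hfree : H.CliqueFree 4) {a b c d : V} (hab : H.Adj a b)
    (hac : H.Adj a c) (hbc : H.Adj b c) (had : H.Adj a d) (hbd : H.Adj b d) : ¬ H.Adj c d := by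
  classical
  intro hcd
  refine hfree {a, b, c, d} ⟨?_, ?_⟩
  · intro x hx y hy hxy
    simp only [Finset.coe_insert, Finset.coe_singleton, Set.mem_insert_iff,
      Set.mem_singleton_iff] at hx hy
    rcases hx with rfl | rfl | rfl | rfl <;> rcases hy with rfl | rfl | rfl | rfl <;>
      first | exact absurd rfl hxy | assumption | (apply SimpleGraph.Adj.symm; assumption)
  · simp [hab.ne, hac.ne, had.ne, hbc.ne, hbd.ne, hcd.ne]

lemma ConnectedOn.deleteEdge {b c : V} (h : ConnectedOn G A) (hc : c ∉ A ∨ b ∉ A) :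
    ConnectedOn (G.deleteEdges {s(b, c)}) A := by
  refine ⟨h.1, fun X hX hne hcl => h.2 X hX hne fun x hx y hy hxy => hcl x hx y hy ?_⟩
  rw [deleteEdges_adj]
  refine ⟨hxy, fun h => ?_⟩
  have hxA := hX hx
  rcases Sym2.eq_iff.1 h with ⟨rfl, rfl⟩ | ⟨rfl, rfl⟩ <;> tauto

lemma Touches.deleteEdge {b c : V} (h : Touches G A B) (hb : b ∉ A) (hc : c ∉ A) :
    Touches (G.deleteEdges {s(b, c)}) A B := by
  obtain ⟨x, hx, y, hy, hxy⟩ := h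
  refine ⟨x, hx, y, hy, ?_⟩
  rw [deleteEdges_adj]
  refine ⟨hxy, fun h => ?_⟩
  rcases Sym2.eq_iff.1 h with ⟨rfl, rfl⟩ | ⟨rfl, rfl⟩ <;> tauto

lemma labelClass_ne_none {ι : Type} {L : V → Option ι} {i : ι} {x : V}
    (hx : x ∈ labelClass L i) : L x ≠ none := by
  rw [show L x = some i from hx]; simp

/-- Marks are inherited after the deletion of a simplicial vertex `v`, provided that the edges
joining two neighbours of `v` become marked. -/
lemma Touches.of_mark_diff {M' : SimpleGraph V} {L : V → Option (Bool × Fin 3)}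
    {i j : Bool × Fin 3} (h : Touches M (labelClass L i) (labelClass L j)) (hMH : M ≤ H)
    (hMM : M ≤ M') (hM' : ∀ x y, H.Adj x y → H.Adj v x → H.Adj v y → M'.Adj x y)
    (hs : ∀ x, L x ≠ none → ∀ y, L y ≠ none → H.Adj v x → H.Adj v y → x ≠ y → H.Adj x y)
    (hij : i ≠ j)
    (hi : v ∈ labelClass L i → ConnectedOn H (labelClass L i) ∧ labelClass L i ≠ {v})
    (hj : v ∈ labelClass L j → ConnectedOn H (labelClass L j) ∧ labelClass L j ≠ {v}) :
    Touches M' (labelClass L i \ {v}) (labelClass L j \ {v}) := by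
  obtain ⟨x, hx, y, hy, hxy⟩ := h
  by_cases hxv : x = v
  · subst hxv
    obtain ⟨u, hu, hvu⟩ := (hi hx).1.exists_adj hx (hi hx).2
    exact ⟨u, ⟨hu, hvu.ne'⟩, y, ⟨hy, hxy.ne'⟩, hM' _ _
      (hs u (labelClass_ne_none hu) y (labelClass_ne_none hy) hvu (hMH hxy)
      ((disjoint_labelClass L hij).ne_of_mem hu hy)) hvu (hMH hxy)⟩
  by_cases hyv : y = v
  · subst hyv
    obtain ⟨u, hu, hvu⟩ := (hj hy).1.exists_adj hy (hj hy).2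
    exact ⟨x, ⟨hx, hxy.ne⟩, u, ⟨hu, hvu.ne'⟩, hM' _ _
      (hs x (labelClass_ne_none hx) u (labelClass_ne_none hu) (hMH hxy).symm hvu
      ((disjoint_labelClass L hij).ne_of_mem hx hu)) (hMH hxy).symm hvu⟩
  exact ⟨x, ⟨hx, hxv⟩, y, ⟨hy, hyv⟩, hMM hxy⟩

/-- If a simplicial vertex forms one of the three central sets of a sun model, then it spans
a triangle with all three edges blocked. -/
lemma IsEliminable.exists_blocked_of_singleton [Finite V] (hH : IsEliminable H)
    (hfree : H.CliqueFree 4) (hMH : M ≤ H) {L : V → Option (Bool × Fin 3)}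
    (hL : IsSunModel H M L)
    (hs : ∀ x, L x ≠ none → ∀ y, L y ≠ none → H.Adj v x → H.Adj v y → x ≠ y → H.Adj x y)
    {i j k : Fin 3} (hij : i ≠ j) (hik : i ≠ k) (hjk : j ≠ k)
    (hv : labelClass L (true, i) = {v}) :
    ∃ a b c, L a ≠ none ∧ L b ≠ none ∧ L c ≠ none ∧ H.Adj a b ∧ H.Adj b c ∧ H.Adj c a ∧
      IsBlocked H M a b c ∧ IsBlocked H M b c a ∧ IsBlocked H M c a b := by
  have hnb : ∀ l, i ≠ l → ∃ x ∈ labelClass L (true, l), H.Adj v x := by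
    intro l hl
    obtain ⟨x, hx, y, hy, hxy⟩ := hL.touches i l hl
    rw [hv] at hx
    exact ⟨y, hy, hx ▸ hxy⟩
  obtain ⟨b, hb, hvb⟩ := hnb j hij
  obtain ⟨c, hc, hvc⟩ := hnb k hik
  have hbc : H.Adj b c := hs b (labelClass_ne_none hb) c (labelClass_ne_none hc) hvb hvc
    ((disjoint_labelClass L (by simpa using hjk)).ne_of_mem hb hc)
  have honly : ∀ x, L x ≠ none → H.Adj v x → x = b ∨ x = c := by
    intro x hx hvx
    by_contra! hcon
    exact not_adj_of_cliqueFree_four hfree hvb hvc hbc hvx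
      (hs b (labelClass_ne_none hb) x hx hvb hvx hcon.1.symm)
      (hs c (labelClass_ne_none hc) x hx hvc hvx hcon.2.symm)
  have hmark : ∀ l m, i ≠ l → i ≠ m → l ≠ m → Touches M {v} (labelClass L (true, l)) := by
    intro l m hil him hlm
    rcases hL.ear m with h | ⟨-, h⟩
    · rw [← hv]
      exact h i l him.symm hlm.symm hil
    · obtain ⟨x, hx, y, hy, hxy⟩ := h i him.symm
      rw [hv] at hy
      rcases honly x (labelClass_ne_none hx) (by rw [← show y = v from hy]; exact hxy.symm)
        with rfl | rfl
      · exact absurd (hx.symm.trans hb) (by simp)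
      · exact absurd (hx.symm.trans hc) (by simp)
  have hvbM : M.Adj v b := by
    obtain ⟨x, rfl, y, hy, hxy⟩ := hmark j k hij hik hjk
    rcases honly y (labelClass_ne_none hy) (hMH hxy) with rfl | rfl
    · exact hxy
    · exact absurd (hy.symm.trans hc) (by simpa using hjk)
  have hvcM : M.Adj v c := by
    obtain ⟨x, rfl, y, hy, hxy⟩ := hmark k j hik hij hjk.symm
    rcases honly y (labelClass_ne_none hy) (hMH hxy) with rfl | rfl
    · exact absurd (hy.symm.trans hb) (by simpa using hjk.symm)
    · exact hxy
  refine ⟨v, b, c, labelClass_ne_none (show v ∈ labelClass L (true, i) by simp [hv]),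
    labelClass_ne_none hb, labelClass_ne_none hc, hvb, hbc, hvc.symm, Or.inl hvbM, ?_,
    Or.inl hvcM.symm⟩
  have hvL : L v = some (true, i) := show v ∈ labelClass L (true, i) by simp [hv]
  have hbL : L b = some (true, j) := hb
  have hcL : L c = some (true, k) := hc
  have hcB : c ∉ labelClass L (true, j) := by simp [labelClass, hcL, hjk.symm]
  have hbC : b ∉ labelClass L (true, k) := by simp [labelClass, hbL, hjk]
  have hB := (hL.conn j).deleteEdge (b := b) (Or.inl hcB)
  have hC := (hL.conn k).deleteEdge (c := c) (Or.inr hbC)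
  rcases hL.ear i with h | ⟨hP, h⟩
  · obtain ⟨x, hx, y, hy, hxy⟩ := h j k hij hik hjk
    by_cases hxb : x = b ∧ y = c
    · exact Or.inl (hxb.1 ▸ hxb.2 ▸ hxy)
    · obtain ⟨d, hd, hbd, hcd⟩ := hH.exists_common_neighbor hbc (Or.inl hb) (Or.inr hc)
        (hB.union hC ⟨x, hx, y, hy, by
          rw [deleteEdges_adj]
          refine ⟨hMH hxy, fun h => ?_⟩
          rcases Sym2.eq_iff.1 h with h | ⟨rfl, -⟩
          · exact hxb h
          · exact hcB hx⟩)
      refine Or.inr ⟨d, ?_, hbd, hcd⟩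
      rintro rfl
      simp [labelClass, hvL, hij, hik] at hd
  · obtain ⟨d, hd, hbd, hcd⟩ := hH.exists_common_neighbor hbc (T := labelClass L (true, j) ∪
        labelClass L (false, i) ∪ labelClass L (true, k)) (Or.inl (Or.inl hb)) (Or.inr hc)
        ((hB.union (hP.deleteEdge (Or.inl (by simp [labelClass, hcL])))
          ((h j hij).deleteEdge (by simp [labelClass, hbL]) (by simp [labelClass, hcL])).symm).union
          hC (by
            obtain ⟨x, hx, y, hy, hxy⟩ := (h k hik).deleteEdge (b := b) (c := c)
              (by simp [labelClass, hbL]) (by simp [labelClass, hcL])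
            exact ⟨x, Or.inr hx, y, hy, hxy⟩))
    refine Or.inr ⟨d, ?_, hbd, hcd⟩
    rintro rfl
    simp [labelClass, hvL, hij, hik] at hd

open Classical in
/-- A sun model in an eliminable graph without 4-clique yields a triangle all of whose edges are
blocked. -/
lemma IsEliminable.exists_blocked [Finite V] (hH : IsEliminable H)
    (hfree : H.CliqueFree 4) (hMH : M ≤ H) {L : V → Option (Bool × Fin 3)}
    (hL : IsSunModel H M L) :
    ∃ a b c, L a ≠ none ∧ L b ≠ none ∧ L c ≠ none ∧ H.Adj a b ∧ H.Adj b c ∧ H.Adj c a ∧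
      IsBlocked H M a b c ∧ IsBlocked H M b c a ∧ IsBlocked H M c a b := by
  induction hT : {x | L x ≠ none} using WellFoundedLT.induction generalizing L M with
  | ind T ih =>
  subst hT
  obtain ⟨v, hv, hs⟩ := hH {x | L x ≠ none} ((hL.conn 0).1.mono fun x hx => labelClass_ne_none hx)
  by_cases hsing : ∃ i, labelClass L (true, i) = {v}
  · obtain ⟨i, hi⟩ := hsing
    obtain ⟨j, k, hij, hik, hjk⟩ : ∃ j k : Fin 3, i ≠ j ∧ i ≠ k ∧ j ≠ k :=
      (by decide : ∀ i : Fin 3, ∃ j k : Fin 3, i ≠ j ∧ i ≠ k ∧ j ≠ k) i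
    exact hH.exists_blocked_of_singleton hfree hMH hL hs hij hik hjk hi
  push Not at hsing
  let M' : SimpleGraph V :=
    { Adj := fun x y => M.Adj x y ∨ (H.Adj x y ∧ H.Adj v x ∧ H.Adj v y)
      symm := ⟨fun x y h => by
        rcases h with h | ⟨h1, h2, h3⟩
        · exact Or.inl h.symm
        · exact Or.inr ⟨h1.symm, h3, h2⟩⟩
      loopless := ⟨fun x h => by
        rcases h with h | ⟨h, -⟩
        · exact h.ne rfl
        · exact h.ne rfl⟩ }
  have hM'H : M' ≤ H := fun x y h => h.elim (fun h => hMH h) fun h => h.1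
  have hMM' : M ≤ M' := fun x y h => Or.inl h
  have hM' : ∀ x y, H.Adj x y → H.Adj v x → H.Adj v y → M'.Adj x y :=
    fun x y h1 h2 h3 => Or.inr ⟨h1, h2, h3⟩
  have hin : ∀ i, v ∈ labelClass L (true, i) →
      ConnectedOn H (labelClass L (true, i)) ∧ labelClass L (true, i) ≠ {v} :=
    fun i _ => ⟨hL.conn i, hsing i⟩
  have hL' : IsSunModel H M' (Function.update L v none) := by
    refine ⟨fun i => ?_, fun i j hij => ?_, fun i => ?_⟩
    · rw [labelClass_update_none]
      by_cases hvi : v ∈ labelClass L (true, i)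
      · exact (hL.conn i).diff_simplicial hvi (hsing i) fun x hx y hy =>
          hs x (labelClass_ne_none hx) y (labelClass_ne_none hy)
      · rw [Set.sdiff_singleton_eq_self hvi]
        exact hL.conn i
    · rw [labelClass_update_none, labelClass_update_none]
      exact (hL.touches i j hij).diff_diff_simplicial (by simpa using hij) (hin i) (hin j) hs
    · simp only [labelClass_update_none]
      rcases hL.ear i with h | ⟨hP, h⟩
      · exact Or.inl fun j k hij hik hjk => (h j k hij hik hjk).of_mark_diff hMH hMM' hM' hs
          (by simpa using hjk) (hin j) (hin k)
      · by_cases hPv : labelClass L (false, i) = {v}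
        · left
          intro j k hij hik hjk
          obtain ⟨x, hx, y, hy, hxy⟩ := h j hij
          obtain ⟨x', hx', z, hz, hxz⟩ := h k hik
          rw [hPv] at hx hx'
          rw [show x = v from hx] at hxy
          rw [show x' = v from hx'] at hxz
          exact ⟨y, ⟨hy, hxy.ne'⟩, z, ⟨hz, hxz.ne'⟩, hM' _ _ (hs y (labelClass_ne_none hy) z
            (labelClass_ne_none hz) hxy hxz
            ((disjoint_labelClass L (by simpa using hjk)).ne_of_mem hy hz)) hxy hxz⟩
        · right
          refine ⟨?_, fun j hij => (h j hij).diff_diff_simplicial (by simp)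
            (fun _ => ⟨hP, hPv⟩) (hin j) hs⟩
          by_cases hvi : v ∈ labelClass L (false, i)
          · exact hP.diff_simplicial hvi hPv fun x hx y hy =>
              hs x (labelClass_ne_none hx) y (labelClass_ne_none hy)
          · rwa [Set.sdiff_singleton_eq_self hvi]
  have hupd : ∀ x, Function.update L v none x ≠ none → L x ≠ none ∧ x ≠ v := by
    intro x hx
    by_cases hxv : x = v
    · simp [hxv] at hx
    · exact ⟨by simpa [hxv] using hx, hxv⟩
  obtain ⟨a, b, c, ha, hb, hc, hab, hbc, hca, h1, h2, h3⟩ :=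
    ih {x | Function.update L v none x ≠ none}
      ⟨fun x hx => (hupd x hx).1, fun h => by simpa using h hv⟩ hM'H hL' rfl
  have hblock : ∀ x y z, z ≠ v → IsBlocked H M' x y z → IsBlocked H M x y z := by
    rintro x y z hz ((h | ⟨h, hx, hy⟩) | h)
    · exact Or.inl h
    · exact Or.inr ⟨v, hz.symm, hx.symm, hy.symm⟩
    · exact Or.inr h
  exact ⟨a, b, c, (hupd a ha).1, (hupd b hb).1, (hupd c hc).1, hab, hbc, hca,
    hblock _ _ _ (hupd c hc).2 h1, hblock _ _ _ (hupd a ha).2 h2, hblock _ _ _ (hupd b hb).2 h3⟩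

end BlockedTriangle

section Chordal

variable {V : Type} {G H M : SimpleGraph V}

lemma cycGraph_adj {n : ℕ} {x y : ZMod n} :
    (cycGraph n).Adj x y ↔ x ≠ y ∧ (x = y + 1 ∨ y = x + 1) := by
  simp [cycGraph, fromRel_adj]

lemma IsEliminable.isChordal (hH : IsEliminable H) : IsChordal H := by
  rintro S n hn ⟨e⟩
  have : Fact (1 < n) := ⟨by lia⟩
  obtain ⟨v, hv, hs⟩ := hH S ⟨_, (e.symm 0).2⟩
  have hcast : ∀ k : ℕ, 0 < k → k < n → (k : ZMod n) ≠ 0 := fun k h0 hk h =>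
    absurd (Nat.le_of_dvd h0 ((ZMod.natCast_eq_zero_iff k n).1 h)) (by lia)
  have h1 : (1 : ZMod n) ≠ 0 := by exact_mod_cast hcast 1 (by lia) (by lia)
  have h2 : (2 : ZMod n) ≠ 0 := by exact_mod_cast hcast 2 (by lia) (by lia)
  have h3 : (3 : ZMod n) ≠ 0 := by exact_mod_cast hcast 3 (by lia) (by lia)
  set z := e ⟨v, hv⟩ with hz
  have hadj : ∀ w, (cycGraph n).Adj z w → H.Adj v (e.symm w) := by
    intro w hw
    have : (H.induce S).Adj (e.symm z) (e.symm w) := e.symm.map_adj_iff.2 hw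
    rw [hz, e.symm_apply_apply] at this
    exact this
  have key := hs _ (e.symm (z + 1)).2 _ (e.symm (z - 1)).2
    (hadj _ (cycGraph_adj.2 ⟨by simp, Or.inr rfl⟩))
    (hadj _ (cycGraph_adj.2 ⟨fun h => h1 (by linear_combination h), Or.inl (by ring)⟩))
    (fun h => h2 (by
      have := e.symm.injective (Subtype.ext h)
      linear_combination this))
  have key' : (H.induce S).Adj (e.symm (z + 1)) (e.symm (z - 1)) := key
  rw [e.symm.map_adj_iff, cycGraph_adj] at key'
  rcases key'.2 with h | h
  · exact h1 (by linear_combination h)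
  · exact h3 (by linear_combination -h)

/-- A chordal graph has no induced cycle given by a sequence of vertices. -/
lemma IsChordal.not_induced_cycle (hH : IsChordal H) {n : ℕ} (hn : 4 ≤ n) (g : ℕ → V)
    (hinj : ∀ i < n, ∀ j < n, g i = g j → i = j)
    (hadj : ∀ i j, i < j → j < n → (H.Adj (g i) (g j) ↔ (j = i + 1 ∨ (i = 0 ∧ j = n - 1)))) :
    False := by
  have : NeZero n := ⟨by lia⟩
  have h1n : Fact (1 < n) := ⟨by lia⟩
  let F : ZMod n → Set.range (fun x : ZMod n => g x.val) := fun x => ⟨g x.val, x, rfl⟩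
  have hF : Function.Bijective F := by
    refine ⟨fun x y h => ?_, ?_⟩
    · exact ZMod.val_injective n
        (hinj _ (ZMod.val_lt x) _ (ZMod.val_lt y) (congrArg Subtype.val h))
    · rintro ⟨_, x, rfl⟩
      exact ⟨x, rfl⟩
  have hval : ∀ x y : ZMod n, y = x + 1 ↔
      (y.val = x.val + 1 ∨ (x.val = n - 1 ∧ y.val = 0)) := by
    intro x y
    have hx := ZMod.val_lt x
    have hy := ZMod.val_lt y
    rw [← (ZMod.val_injective n).eq_iff, ZMod.val_add, ZMod.val_one]
    by_cases h : x.val + 1 < n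
    · rw [Nat.mod_eq_of_lt h]
      lia
    · rw [show x.val + 1 = n by lia, Nat.mod_self]
      lia
  have hlt : ∀ x y : ZMod n, x.val < y.val →
      (H.Adj (g x.val) (g y.val) ↔ (cycGraph n).Adj x y) := by
    intro x y hxy
    rw [hadj _ _ hxy (ZMod.val_lt y), cycGraph_adj, hval, hval]
    have : x ≠ y := fun h => by simp [h] at hxy
    have hx := ZMod.val_lt x
    have hy := ZMod.val_lt y
    simp only [ne_eq, this, not_false_eq_true, true_and]
    lia
  refine hH _ n hn ⟨(RelIso.symm ⟨Equiv.ofBijective F hF, ?_⟩)⟩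
  intro x y
  change H.Adj (g x.val) (g y.val) ↔ _
  rcases lt_trichotomy x.val y.val with h | h | h
  · exact hlt x y h
  · obtain rfl := ZMod.val_injective n h
    simp
  · rw [H.adj_comm, (cycGraph n).adj_comm]
    exact hlt y x h

/-- Two vertices with neighbours in a common connected set `C` are joined by an induced path
through `C`. -/
lemma exists_induced_path {C : Set V} (hC : ConnectedOn G C) {x y : V}
    (hx : ∃ c ∈ C, G.Adj x c) (hy : ∃ c ∈ C, G.Adj y c) (hxy : x ≠ y) :
    ∃ (k : ℕ) (p : ℕ → V), p 0 = x ∧ p k = y ∧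
      (∀ i ≤ k, ∀ j ≤ k, p i = p j → i = j) ∧
      (∀ i, 0 < i → i < k → p i ∈ C) ∧
      (∀ i j, i < j → j ≤ k → (G.Adj (p i) (p j) ↔ j = i + 1)) := by
  classical
  let P : ℕ → Prop := fun k => ∃ p : ℕ → V, p 0 = x ∧ p k = y ∧
    (∀ i, 0 < i → i < k → p i ∈ C) ∧ ∀ i < k, G.Adj (p i) (p (i + 1))
  have hP : ∃ k, P k := by
    obtain ⟨c, hc, hxc⟩ := hx
    obtain ⟨d, hd, hyd⟩ := hy
    have := hC.2 {z | z ∈ C ∧ ∃ (k : ℕ) (p : ℕ → V), p 0 = x ∧ p (k + 1) = z ∧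
        (∀ i, 0 < i → i ≤ k + 1 → p i ∈ C) ∧ ∀ i < k + 1, G.Adj (p i) (p (i + 1))}
      (fun z hz => hz.1)
      ⟨c, hc, 0, fun i => if i = 0 then x else c, by simp, by simp, by
        intro i h _; simpa [h.ne'] using hc, by
        intro i h; obtain rfl : i = 0 := by lia
        simpa using hxc⟩ (by
        rintro z ⟨hz, k, p, h0, hk, hpC, hp⟩ w hw hzw
        refine ⟨hw, k + 1, fun i => if i = k + 2 then w else p i, by simp [h0], by simp, ?_, ?_⟩
        · intro i hi hik
          by_cases h : i = k + 2
          · simpa [h] using hw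
          · simpa [h] using hpC i hi (by lia)
        · intro i hi
          by_cases h : i = k + 1
          · simpa [h, hk] using hzw
          · have h1 : i ≠ k + 2 := by lia
            simpa [h, h1] using hp i (by lia)) hd
    obtain ⟨-, k, p, h0, hk, hpC, hp⟩ := this
    refine ⟨k + 2, fun i => if i = k + 2 then y else p i, by simp [h0], by simp, ?_, ?_⟩
    · intro i hi hik
      simpa [hik.ne] using hpC i hi (by lia)
    · intro i hi
      by_cases h : i = k + 1
      · simpa [h, hk] using hyd.symm
      · have h1 : i ≠ k + 2 := by lia
        simpa [h, h1] using hp i (by lia)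
  obtain ⟨p, h0, hk, hpC, hp⟩ := Nat.find_spec hP
  set k := Nat.find hP with hkdef
  have hmin : ∀ m < k, ¬ P m := fun m hm => Nat.find_min hP hm
  have hshort : ∀ i j, i < j → j ≤ k → G.Adj (p i) (p j) → j = i + 1 := by
    intro i j hij hj h
    by_contra hne
    refine hmin (k - (j - i - 1)) (by lia)
      ⟨fun t => if t ≤ i then p t else p (t + (j - i - 1)), by simp [h0], ?_, ?_, ?_⟩
    · have h1 : ¬ k - (j - i - 1) ≤ i := by lia
      simp only [h1, if_false]
      rw [show k - (j - i - 1) + (j - i - 1) = k by lia, hk]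
    · intro t ht htk
      by_cases h1 : t ≤ i
      · simpa [h1] using hpC t ht (by lia)
      · simpa [h1] using hpC (t + (j - i - 1)) (by lia) (by lia)
    · intro t ht
      rcases lt_trichotomy t i with h1 | rfl | h1
      · have h2 : t + 1 ≤ i := h1
        simpa [h1.le, h2] using hp t (by lia)
      · simpa [show t + 1 + (j - t - 1) = j by lia] using h
      · have h2 : ¬ t ≤ i := by lia
        have h3 : ¬ t + 1 ≤ i := by lia
        simp only [h2, h3, if_false]
        rw [show t + 1 + (j - i - 1) = t + (j - i - 1) + 1 by lia]
        exact hp _ (by lia)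
  have hne : ∀ i j, i < j → j ≤ k → p i ≠ p j := by
    intro i j hij hj h
    rcases Nat.eq_zero_or_pos i with rfl | hi
    · rcases hj.lt_or_eq with hj' | rfl
      · have := hshort 0 (j + 1) (by lia) (by lia) (h ▸ hp j hj')
        lia
      · exact hxy (by rw [← h0, ← hk, h])
    · have := hp (i - 1) (by lia)
      rw [show i - 1 + 1 = i by lia, h] at this
      have := hshort (i - 1) j (by lia) hj this
      lia
  refine ⟨k, p, h0, hk, fun i hi j hj h => ?_, hpC, fun i j hij hj => ⟨hshort i j hij hj, ?_⟩⟩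
  · rcases lt_trichotomy i j with h1 | h1 | h1
    · exact absurd h (hne i j h1 hj)
    · exact h1
    · exact absurd h.symm (hne j i h1 hi)
  · rintro rfl
    exact hp i (by lia)

/-- In a chordal graph, two neighbours of `u` that both have neighbours in a connected set
without neighbours of `u` are adjacent. -/
lemma IsChordal.adj_of_connectedOn (hH : IsChordal H) {C : Set V} (hC : ConnectedOn H C)
    {u x y : V} (hux : H.Adj u x) (huy : H.Adj u y) (hxy : x ≠ y) (huC : u ∉ C)
    (hun : ∀ c ∈ C, ¬ H.Adj u c) (hx : ∃ c ∈ C, H.Adj x c) (hy : ∃ c ∈ C, H.Adj y c) :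
    H.Adj x y := by
  by_contra hnadj
  obtain ⟨k, p, h0, hk, hinj, hpC, hadj⟩ := exists_induced_path hC hx hy hxy
  have hk0 : k ≠ 0 := by rintro rfl; exact hxy (h0.symm.trans hk)
  have hk1 : k ≠ 1 := by
    rintro rfl
    exact hnadj (by rw [← h0, ← hk]; exact (hadj 0 1 (by lia) le_rfl).2 rfl)
  have hup : ∀ i ≤ k, p i ≠ u := by
    intro i hi h
    by_cases hi0 : i = 0
    · exact hux.ne (by rw [← h, hi0, h0])
    by_cases hik : i = k
    · exact huy.ne (by rw [← h, hik, hk])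
    exact huC (h ▸ hpC i (by lia) (by lia))
  refine hH.not_induced_cycle (n := k + 2) (by lia) (fun i => if i = k + 1 then u else p i) ?_ ?_
  · intro i hi j hj h
    by_cases h1 : i = k + 1 <;> by_cases h2 : j = k + 1
    · lia
    · simp only [h1, h2, if_true, if_false] at h
      exact absurd h.symm (hup j (by lia))
    · simp only [h1, h2, if_true, if_false] at h
      exact absurd h (hup i (by lia))
    · simp only [h1, h2, if_false] at h
      exact hinj i (by lia) j (by lia) h
  · intro i j hij hj
    have h1 : i ≠ k + 1 := by lia
    by_cases h2 : j = k + 1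
    · simp only [h1, h2, if_true, if_false]
      by_cases hi0 : i = 0
      · simp [hi0, h0, hux.symm]
      by_cases hik : i = k
      · simp [hik, hk, huy.symm]
      have : ¬ H.Adj (p i) u := fun h => hun _ (hpC i (by lia) (by lia)) h.symm
      simp only [this, false_iff]
      lia
    · simp only [h1, h2, if_false]
      rw [hadj i j hij (by lia)]
      lia

/-- Dirac's lemma: in a chordal graph, unless `u` dominates the set `T`, there is a simplicial
vertex of `T` that is neither `u` nor adjacent to it. -/
lemma IsChordal.exists_simplicial_not_adj [Finite V] (hH : IsChordal H) {T : Set V} {u w : V}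
    (hu : u ∈ T) (hw : w ∈ T) (hwu : w ≠ u) (huw : ¬ H.Adj u w) :
    ∃ v ∈ T, v ≠ u ∧ ¬ H.Adj u v ∧
      ∀ x ∈ T, ∀ y ∈ T, H.Adj v x → H.Adj v y → x ≠ y → H.Adj x y := by
  induction T using WellFoundedLT.induction generalizing u w with
  | ind T ih =>
  obtain ⟨C, hCsub, -, hC, hcl⟩ := exists_component H
    (A := {x | x ∈ T ∧ x ≠ u ∧ ¬ H.Adj u x}) (c := w) ⟨hw, hwu, huw⟩
  let N : Set V := {x | x ∈ T ∧ H.Adj u x ∧ ∃ c ∈ C, H.Adj x c}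
  have hnbr : ∀ c ∈ C, ∀ x ∈ T, H.Adj c x → x ∈ C ∪ N := by
    intro c hc x hx hcx
    by_cases hux : H.Adj u x
    · exact Or.inr ⟨hx, hux, c, hc, hcx.symm⟩
    · refine Or.inl (hcl c hc x ⟨hx, ?_, hux⟩ hcx)
      rintro rfl
      exact (hCsub hc).2.2 hcx.symm
  have hN : ∀ x ∈ N, ∀ y ∈ N, x ≠ y → H.Adj x y := fun x hx y hy hxy =>
    hH.adj_of_connectedOn hC hx.2.1 hy.2.1 hxy (fun h => (hCsub h).2.1 rfl)
      (fun c hc => (hCsub hc).2.2) hx.2.2 hy.2.2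
  have hsub : C ∪ N ⊂ T := by
    refine ⟨Set.union_subset (fun x hx => (hCsub hx).1) fun x hx => hx.1, fun h => ?_⟩
    rcases h hu with h | h
    · exact (hCsub h).2.1 rfl
    · exact h.2.1.ne rfl
  suffices h : ∃ v ∈ C, ∀ x ∈ C ∪ N, ∀ y ∈ C ∪ N, H.Adj v x → H.Adj v y → x ≠ y → H.Adj x y by
    obtain ⟨v, hv, hs⟩ := h
    exact ⟨v, (hCsub hv).1, (hCsub hv).2.1, (hCsub hv).2.2, fun x hx y hy hvx hvy hxy =>
      hs x (hnbr v hv x hx hvx) y (hnbr v hv y hy hvy) hvx hvy hxy⟩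
  by_cases hdom : ∃ t ∈ N, ∃ w ∈ C ∪ N, w ≠ t ∧ ¬ H.Adj t w
  · obtain ⟨t, ht, w, hw, hwt, htw⟩ := hdom
    obtain ⟨v, hv, hvt, htv, hs⟩ := ih _ hsub (Or.inr ht) hw hwt htw
    exact ⟨v, hv.resolve_right fun h => htv (hN t ht v h hvt.symm), hs⟩
  push Not at hdom
  by_cases hcl' : ∃ c ∈ C, ∃ w ∈ C, w ≠ c ∧ ¬ H.Adj c w
  · obtain ⟨c, hc, w, hw, hwc, hcw⟩ := hcl'
    obtain ⟨v, hv, hvc, hcv, hs⟩ := ih _ hsub (Or.inl hc) (Or.inl hw) hwc hcw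
    exact ⟨v, hv.resolve_right fun h => hcv (hdom v h c (Or.inl hc) hvc.symm).symm, hs⟩
  push Not at hcl'
  obtain ⟨c, hc⟩ := hC.1
  refine ⟨c, hc, fun x hx y hy _ _ hxy => ?_⟩
  rcases hx with hx | hx
  · rcases hy with hy | hy
    · exact hcl' x hx y hy hxy.symm
    · exact (hdom y hy x (Or.inl hx) hxy).symm
  · exact hdom x hx y hy hxy.symm

lemma IsChordal.isEliminable [Finite V] (hH : IsChordal H) : IsEliminable H := by
  intro T
  induction T using WellFoundedLT.induction with
  | ind T ih =>
  rintro ⟨u, hu⟩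
  by_cases h : ∃ w ∈ T, w ≠ u ∧ ¬ H.Adj u w
  · obtain ⟨w, hw, hwu, huw⟩ := h
    obtain ⟨v, hv, -, -, hs⟩ := hH.exists_simplicial_not_adj hu hw hwu huw
    exact ⟨v, hv, hs⟩
  push Not at h
  by_cases hne : (T \ {u}).Nonempty
  · obtain ⟨v, hv, hs⟩ := ih (T \ {u}) ⟨Set.sdiff_subset, fun h => (h hu).2 rfl⟩ hne
    refine ⟨v, hv.1, fun x hx y hy hvx hvy hxy => ?_⟩
    by_cases hxu : x = u
    · subst hxu
      exact h y hy hxy.symm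
    by_cases hyu : y = u
    · subst hyu
      exact (h x hx hxu).symm
    exact hs x ⟨hx, hxu⟩ y ⟨hy, hyu⟩ hvx hvy hxy
  · refine ⟨u, hu, fun x hx y hy hux => ?_⟩
    exact absurd ⟨x, hx, hux.ne'⟩ hne

end Chordal

section BuildingModels

variable {V : Type} {G H M : SimpleGraph V}

open Classical in
lemma exists_labelling {ι : Type} (F : ι → Set V) (hF : ∀ i j, i ≠ j → Disjoint (F i) (F j)) :
    ∃ L : V → Option ι, ∀ i, labelClass L i = F i := by
  refine ⟨fun x => if h : ∃ i, x ∈ F i then some h.choose else none, fun i => ?_⟩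
  ext x
  by_cases h : ∃ i, x ∈ F i
  · simp only [labelClass, Set.mem_ofPred_eq, h, dite_true, Option.some.injEq]
    constructor
    · intro hi
      exact hi ▸ h.choose_spec
    · intro hi
      by_contra hne
      exact Set.disjoint_left.1 (hF _ _ hne) h.choose_spec hi
  · have : x ∉ F i := fun hi => h ⟨i, hi⟩
    simp [labelClass, h, this]

lemma hasCliqueModel_of_sets {A B C D : Set V}
    (hA : ConnectedOn G A) (hB : ConnectedOn G B) (hC : ConnectedOn G C) (hD : ConnectedOn G D)
    (dAB : Disjoint A B) (dAC : Disjoint A C) (dAD : Disjoint A D) (dBC : Disjoint B C)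
    (dBD : Disjoint B D) (dCD : Disjoint C D)
    (tAB : Touches G A B) (tAC : Touches G A C) (tAD : Touches G A D) (tBC : Touches G B C)
    (tBD : Touches G B D) (tCD : Touches G C D) : HasCliqueModel G := by
  obtain ⟨L, hL⟩ := exists_labelling ![A, B, C, D] (by
    intro i j hij
    fin_cases i <;> fin_cases j <;>
      first | exact absurd rfl hij | assumption | exact Disjoint.symm (by assumption))
  refine ⟨L, fun i => ?_, fun i j hij => ?_⟩
  · rw [hL]
    fin_cases i <;> assumption
  · rw [hL, hL]
    fin_cases i <;> fin_cases j <;>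
      first | exact absurd rfl hij | assumption | exact Touches.symm (by assumption)

lemma exists_isSunModel_of_sets (F : Bool × Fin 3 → Set V)
    (hd : ∀ i j, i ≠ j → Disjoint (F i) (F j))
    (conn : ∀ i, ConnectedOn G (F (true, i)))
    (touch : ∀ i j, i ≠ j → Touches G (F (true, i)) (F (true, j)))
    (ear : ∀ i, (∀ j k, i ≠ j → i ≠ k → j ≠ k → Touches M (F (true, j)) (F (true, k))) ∨
      (ConnectedOn G (F (false, i)) ∧ ∀ j, i ≠ j → Touches G (F (false, i)) (F (true, j)))) :
    ∃ L, IsSunModel G M L := by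
  obtain ⟨L, hL⟩ := exists_labelling F hd
  refine ⟨L, ?_, ?_, ?_⟩ <;> simpa only [hL]

/-- A sun model in which two of the three ears are marked edges. -/
lemma exists_isSunModel_of_two_marks (hMG : M ≤ G) {A B C P : Set V}
    (hA : ConnectedOn G A) (hB : ConnectedOn G B) (hC : ConnectedOn G C)
    (dAB : Disjoint A B) (dAC : Disjoint A C) (dBC : Disjoint B C)
    (dPA : Disjoint P A) (dPB : Disjoint P B) (dPC : Disjoint P C)
    (tAC : Touches M A C) (tBC : Touches M B C) (tAB : Touches G A B)
    (hP : Touches M A B ∨ (ConnectedOn G P ∧ Touches G P A ∧ Touches G P B)) :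
    ∃ L, IsSunModel G M L := by
  refine exists_isSunModel_of_sets
    (fun i => bif i.1 then ![A, B, C] i.2 else ![∅, ∅, P] i.2) ?_ ?_ ?_ ?_
  · rintro ⟨s, i⟩ ⟨t, j⟩ hij
    cases s <;> cases t <;> fin_cases i <;> fin_cases j <;>
      first
        | exact absurd rfl hij
        | assumption
        | exact Disjoint.symm (by assumption)
        | exact Set.empty_disjoint _
        | exact Set.disjoint_empty _
  · intro i
    fin_cases i <;> assumption
  · have tAC' := tAC.mono hMG
    have tBC' := tBC.mono hMG
    intro i j hij
    fin_cases i <;> fin_cases j <;>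
      first | exact absurd rfl hij | assumption | exact Touches.symm (by assumption)
  · intro i
    fin_cases i
    · left
      intro j k hij hik hjk
      fin_cases j <;> fin_cases k <;>
        first
          | exact absurd rfl hij | exact absurd rfl hik | exact absurd rfl hjk
          | assumption | exact Touches.symm (by assumption)
    · left
      intro j k hij hik hjk
      fin_cases j <;> fin_cases k <;>
        first
          | exact absurd rfl hij | exact absurd rfl hik | exact absurd rfl hjk
          | assumption | exact Touches.symm (by assumption)
    · rcases hP with h | ⟨h1, h2, h3⟩
      · left
        intro j k hij hik hjk
        fin_cases j <;> fin_cases k <;>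
          first
            | exact absurd rfl hij | exact absurd rfl hik | exact absurd rfl hjk
            | assumption | exact Touches.symm (by assumption)
      · refine Or.inr ⟨h1, fun j hij => ?_⟩
        fin_cases j <;> first | exact absurd rfl hij | assumption

end BuildingModels

section LowDegree

variable {V : Type} {G : SimpleGraph V} {S : Set V}

/-- If every vertex of a nonempty finite graph has at least three neighbours, then the graph
has a model of `K₄`. -/
lemma exists_degree_le_two [Finite V] (hG : ¬ HasCliqueModel G)
    (hsupp : ∀ x y, G.Adj x y → x ∈ S) (hS : S.Nonempty) :
    ∃ v ∈ S, ∀ x y z, G.Adj v x → G.Adj v y → G.Adj v z → x = y ∨ x = z ∨ y = z := by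
  by_contra! hcon
  apply hG
  let IsPath : ℕ → (ℕ → V) → Prop := fun k p => (∀ i ≤ k, p i ∈ S) ∧
    (∀ i ≤ k, ∀ j ≤ k, p i = p j → i = j) ∧ ∀ i < k, G.Adj (p i) (p (i + 1))
  have hbound : ∀ k, (∃ p, IsPath k p) → k ≤ Nat.card V := by
    rintro k ⟨p, -, hinj, -⟩
    have := Nat.card_le_card_of_injective (fun i : Fin (k + 1) => p i) fun i j h =>
      Fin.ext (hinj i (by lia) j (by lia) h)
    rw [Nat.card_fin] at this
    lia
  obtain ⟨s, hs⟩ := hS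
  have h0 : ∃ p, IsPath 0 p := ⟨fun _ => s, fun _ _ => hs, by lia, by lia⟩
  classical
  obtain ⟨k, ⟨p₀, hp₀⟩, hmax⟩ : ∃ k, (∃ p, IsPath k p) ∧ ∀ m, (∃ p, IsPath m p) → m ≤ k :=
    ⟨Nat.findGreatest (fun k => ∃ p, IsPath k p) (Nat.card V),
      Nat.findGreatest_spec (P := fun k => ∃ p, IsPath k p) (Nat.zero_le _) h0,
      fun m hm => Nat.le_findGreatest (hbound m hm) hm⟩
  have hon : ∀ p, IsPath k p → ∀ z, G.Adj (p 0) z → ∃ i, 1 ≤ i ∧ i ≤ k ∧ p i = z := by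
    rintro p ⟨hpS, hinj, hadj⟩ z hz
    by_contra! hno
    have hno' : ∀ i ≤ k, p i ≠ z := by
      intro i hi
      by_cases h : i = 0
      · rw [h]; exact hz.ne
      · exact hno i (by lia) hi
    have := hmax (k + 1) ⟨fun t => if t = 0 then z else p (t - 1), ?_, ?_, ?_⟩
    · lia
    · intro i hi
      by_cases h : i = 0
      · simpa [h] using hsupp _ _ hz.symm
      · simpa [h] using hpS (i - 1) (by lia)
    · intro i hi j hj hij
      by_cases h1 : i = 0 <;> by_cases h2 : j = 0
      · lia
      · simp only [h1, h2, if_true, if_false] at hij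
        exact absurd hij.symm (hno' _ (by lia))
      · simp only [h1, h2, if_true, if_false] at hij
        exact absurd hij (hno' _ (by lia))
      · simp only [h1, h2, if_false] at hij
        have := hinj _ (by lia) _ (by lia) hij
        lia
    · intro i hi
      by_cases h : i = 0
      · simpa [h] using hz.symm
      · have := hadj (i - 1) (by lia)
        rw [show i - 1 + 1 = i by lia] at this
        simpa [h] using this
  have htwo : ∀ p, IsPath k p → ∃ i j, 2 ≤ i ∧ i < j ∧ j ≤ k ∧
      G.Adj (p 0) (p i) ∧ G.Adj (p 0) (p j) := by
    intro p hp
    obtain ⟨x, y, z, hx, hy, hz, hxy, hxz, hyz⟩ := hcon (p 0) (hp.1 0 (by lia))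
    obtain ⟨i, hi1, hik, rfl⟩ := hon p hp x hx
    obtain ⟨j, hj1, hjk, rfl⟩ := hon p hp y hy
    obtain ⟨l, hl1, hlk, rfl⟩ := hon p hp z hz
    have hij : i ≠ j := fun h => hxy (h ▸ rfl)
    have hil : i ≠ l := fun h => hxz (h ▸ rfl)
    have hjl : j ≠ l := fun h => hyz (h ▸ rfl)
    have hpair : ∀ s t, 2 ≤ s → 2 ≤ t → s ≠ t → s ≤ k → t ≤ k → G.Adj (p 0) (p s) →
        G.Adj (p 0) (p t) → ∃ i j, 2 ≤ i ∧ i < j ∧ j ≤ k ∧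
        G.Adj (p 0) (p i) ∧ G.Adj (p 0) (p j) := by
      intro s t hs ht hst hsk htk h1 h2
      rcases Nat.lt_or_gt_of_ne hst with h | h
      · exact ⟨s, t, hs, h, htk, h1, h2⟩
      · exact ⟨t, s, ht, h, hsk, h2, h1⟩
    by_cases h1 : i = 1
    · exact hpair j l (by lia) (by lia) hjl hjk hlk hy hz
    by_cases h2 : j = 1
    · exact hpair i l (by lia) (by lia) hil hik hlk hx hz
    exact hpair i j (by lia) (by lia) hij hik hjk hx hy
  have hQ : ∃ i, 2 ≤ i ∧ i ≤ k ∧ ∃ p, IsPath k p ∧ G.Adj (p 0) (p i) := by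
    obtain ⟨i, j, hi, hij, hj, h, -⟩ := htwo p₀ hp₀
    exact ⟨i, hi, by lia, p₀, hp₀, h⟩
  obtain ⟨hi2, hik, p, hp, h0i⟩ := Nat.find_spec hQ
  have hmin : ∀ j, 2 ≤ j → j ≤ k → (∃ p, IsPath k p ∧ G.Adj (p 0) (p j)) → Nat.find hQ ≤ j :=
    fun j h1 h2 h3 => Nat.find_min' hQ ⟨h1, h2, h3⟩
  generalize Nat.find hQ = i at hi2 hik h0i hmin
  obtain ⟨j, hij, hjk, h0j⟩ : ∃ j, i < j ∧ j ≤ k ∧ G.Adj (p 0) (p j) := by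
    obtain ⟨s, t, hs, hst, ht, h1, h2⟩ := htwo p hp
    have := hmin s hs (by lia) ⟨p, hp, h1⟩
    exact ⟨t, by lia, ht, h2⟩
  obtain ⟨l, hil, hlk, hl⟩ : ∃ l, i < l ∧ l ≤ k ∧ G.Adj (p (i - 1)) (p l) := by
    let q : ℕ → V := fun t => if t < i then p (i - 1 - t) else p t
    have hq : IsPath k q := by
      refine ⟨fun t ht => ?_, fun s hs t ht hst => ?_, fun t ht => ?_⟩
      · by_cases h : t < i
        · simpa [q, h] using hp.1 _ (by lia)
        · simpa [q, h] using hp.1 _ (by lia)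
      · by_cases h1 : s < i <;> by_cases h2 : t < i <;>
          simp only [q, h1, h2, if_true, if_false] at hst <;>
          · have := hp.2.1 _ (by lia) _ (by lia) hst
            lia
      · rcases lt_trichotomy (t + 1) i with h | h | h
        · have h1 : t < i := by lia
          have := hp.2.2 (i - 1 - (t + 1)) (by lia)
          rw [show i - 1 - (t + 1) + 1 = i - 1 - t by lia] at this
          simpa only [q, h, h1, if_true] using this.symm
        · have h1 : t < i := by lia
          have h2 : ¬ t + 1 < i := by lia
          simp only [q, h1, h2, if_true, if_false]
          rw [show i - 1 - t = 0 by lia, h]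
          exact h0i
        · have h1 : ¬ t < i := by lia
          have h2 : ¬ t + 1 < i := by lia
          simpa only [q, h1, h2, if_false] using hp.2.2 t ht
    obtain ⟨s, t, hs, hst, ht, h1, h2⟩ := htwo q hq
    have := hmin s hs (by lia) ⟨q, hq, h1⟩
    refine ⟨t, by lia, ht, ?_⟩
    have h3 : ¬ t < i := by lia
    have h4 : 0 < i := by lia
    simpa only [q, h3, h4, if_true, if_false, Nat.sub_zero] using h2
  have hdisj : ∀ s t s' t', t < s' → t' ≤ k → Disjoint (p '' Set.Icc s t) (p '' Set.Icc s' t') := by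
    intro s t s' t' h h'
    rw [Set.disjoint_left]
    rintro _ ⟨x, ⟨hx1, hx2⟩, rfl⟩ ⟨y, ⟨hy1, hy2⟩, hxy⟩
    have := hp.2.1 y (by lia) x (by lia) hxy
    lia
  have hconn : ∀ s t, s ≤ t → t ≤ k → ConnectedOn G (p '' Set.Icc s t) := fun s t hst htk =>
    connectedOn_image_Icc hst fun i _ hi => hp.2.2 i (by lia)
  have htouch : ∀ s t s' t' x y, s ≤ x → x ≤ t → s' ≤ y → y ≤ t' → G.Adj (p x) (p y) →
      Touches G (p '' Set.Icc s t) (p '' Set.Icc s' t') := fun s t s' t' x y h1 h2 h3 h4 h =>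
    ⟨_, ⟨x, ⟨h1, h2⟩, rfl⟩, _, ⟨y, ⟨h3, h4⟩, rfl⟩, h⟩
  have hstep : ∀ x, 0 < x → x ≤ k → G.Adj (p (x - 1)) (p x) := fun x hx hxk => by
    have := hp.2.2 (x - 1) (by lia)
    rwa [show x - 1 + 1 = x by lia] at this
  exact hasCliqueModel_of_sets (A := p '' Set.Icc 0 (i - 2)) (B := p '' Set.Icc (i - 1) (i - 1))
    (C := p '' Set.Icc i (min l j - 1)) (D := p '' Set.Icc (min l j) (max l j))
    (hconn _ _ (by lia) (by lia)) (hconn _ _ (by lia) (by lia)) (hconn _ _ (by lia) (by lia))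
    (hconn _ _ (by lia) (by lia)) (hdisj _ _ _ _ (by lia) (by lia))
    (hdisj _ _ _ _ (by lia) (by lia)) (hdisj _ _ _ _ (by lia) (by lia))
    (hdisj _ _ _ _ (by lia) (by lia)) (hdisj _ _ _ _ (by lia) (by lia))
    (hdisj _ _ _ _ (by lia) (by lia))
    (htouch _ _ _ _ (i - 1 - 1) (i - 1) (by lia) (by lia) (by lia) (by lia)
      (hstep _ (by lia) (by lia)))
    (htouch _ _ _ _ 0 i (by lia) (by lia) (by lia) (by lia) h0i)
    (htouch _ _ _ _ 0 j (by lia) (by lia) (by lia) (by lia) h0j)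
    (htouch _ _ _ _ (i - 1) i (by lia) (by lia) (by lia) (by lia) (hstep _ (by lia) (by lia)))
    (htouch _ _ _ _ (i - 1) l (by lia) (by lia) (by lia) (by lia) hl)
    (htouch _ _ _ _ (min l j - 1) (min l j) (by lia) (by lia) (by lia) (by lia)
      (hstep _ (by lia) (by lia)))

end LowDegree

section Bypass

variable {V : Type} {G M G' M' : SimpleGraph V} {A B S : Set V} {v a b : V}

lemma ConnectedOn.not_mem_of_isolated (hA : ConnectedOn G A) (hAB : Touches G A B)
    (hv : ∀ x, ¬ G.Adj v x) : v ∉ A := by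
  intro hvA
  by_cases hne : A = {v}
  · obtain ⟨x, hx, y, -, hxy⟩ := hAB
    rw [hne] at hx
    obtain rfl := hx
    exact hv y hxy
  · obtain ⟨u, -, hu⟩ := hA.exists_adj hvA hne
    exact hv u hu

/-- The set `A`, together with `v` in case `A` contains `a`. -/
def extendTo (v a : V) (A : Set V) : Set V := {x | x ∈ A ∨ x = v ∧ a ∈ A}

lemma labelClass_update [DecidableEq V] {ι : Type} {L : V → Option ι} {i : ι} (hva : v ≠ a)
    (hv : v ∉ labelClass L i) :
    labelClass (Function.update L v (L a)) i = extendTo v a (labelClass L i) := by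
  ext x
  simp only [labelClass, extendTo, Set.mem_ofPred_eq] at *
  by_cases hx : x = v
  · subst hx; simp [hv]
  · simp [hx]

lemma ConnectedOn.extendTo (hA : ConnectedOn G' A)
    (hG' : ∀ x y, G'.Adj x y → G.Adj x y ∨ (x = a ∧ y = b ∨ x = b ∧ y = a))
    (ha : G.Adj v a) (hb : G.Adj v b) : ConnectedOn G (extendTo v a A) := by
  obtain ⟨w, hw⟩ := hA.1
  refine ⟨⟨w, Or.inl hw⟩, fun X hX ⟨u, hu⟩ hcl => ?_⟩
  have key : A ⊆ X ∩ A := by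
    refine hA.2 _ (fun x hx => hx.2) ?_ ?_
    · rcases hX hu with h | ⟨rfl, h⟩
      · exact ⟨u, hu, h⟩
      · exact ⟨a, hcl _ hu _ (Or.inl h) ha, h⟩
    · rintro x ⟨hx, hxA⟩ y hy hxy
      refine ⟨?_, hy⟩
      rcases hG' x y hxy with h | ⟨rfl, rfl⟩ | ⟨rfl, rfl⟩
      · exact hcl _ hx _ (Or.inl hy) h
      · exact hcl v (hcl _ hx _ (Or.inr ⟨rfl, hxA⟩) ha.symm) _ (Or.inl hy) hb
      · exact hcl v (hcl _ hx _ (Or.inr ⟨rfl, hy⟩) hb.symm) _ (Or.inl hy) ha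
  rintro x (hx | ⟨rfl, h⟩)
  · exact (key hx).1
  · exact hcl a (key h).1 _ (Or.inr ⟨rfl, h⟩) ha.symm

lemma Touches.extendTo (hAB : Touches G' A B)
    (hG' : ∀ x y, G'.Adj x y → G.Adj x y ∨ G.Adj v b ∧ (x = a ∧ y = b ∨ x = b ∧ y = a)) :
    Touches G (extendTo v a A) (extendTo v a B) := by
  obtain ⟨x, hx, y, hy, hxy⟩ := hAB
  rcases hG' x y hxy with h | ⟨h, ⟨rfl, rfl⟩ | ⟨rfl, rfl⟩⟩
  · exact ⟨x, Or.inl hx, y, Or.inl hy, h⟩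
  · exact ⟨v, Or.inr ⟨rfl, hx⟩, y, Or.inl hy, h⟩
  · exact ⟨x, Or.inl hx, v, Or.inr ⟨rfl, hy⟩, h.symm⟩

/-- `G'` is obtained from `G` by deleting the vertex `v`, which has the two neighbours `a` and `b`,
and joining `a` and `b` by an edge. -/
structure IsBypass (G G' : SimpleGraph V) (v a b : V) : Prop where
  ne : a ≠ b
  adj_iff : ∀ x, G.Adj v x ↔ x = a ∨ x = b
  adj_iff' : ∀ x y, G'.Adj x y ↔ G.Adj x y ∧ x ≠ v ∧ y ≠ v ∨ (x = a ∧ y = b ∨ x = b ∧ y = a)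

namespace IsBypass

lemma swap (h : IsBypass G G' v a b) : IsBypass G G' v b a where
  ne := h.ne.symm
  adj_iff x := by rw [h.adj_iff, or_comm]
  adj_iff' x y := by rw [h.adj_iff', or_comm (a := x = a ∧ y = b)]

lemma adj_left (h : IsBypass G G' v a b) : G.Adj v a := by simp [h.adj_iff]

lemma adj_right (h : IsBypass G G' v a b) : G.Adj v b := by simp [h.adj_iff]

lemma not_adj (h : IsBypass G G' v a b) (x : V) : ¬ G'.Adj v x := by
  have := h.adj_left.ne
  have := h.adj_right.ne
  rw [h.adj_iff']
  grind

lemma adj_or (h : IsBypass G G' v a b) (x y : V) (hxy : G'.Adj x y) :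
    G.Adj x y ∨ (x = a ∧ y = b ∨ x = b ∧ y = a) := by
  rw [h.adj_iff'] at hxy
  grind

lemma hasCliqueModel (h : IsBypass G G' v a b) (hG' : HasCliqueModel G') : HasCliqueModel G := by
  classical
  obtain ⟨L, hc, ht⟩ := hG'
  have hv i : v ∉ labelClass L i := by
    obtain ⟨j, hj⟩ := exists_ne i
    exact (hc i).not_mem_of_isolated (ht i j hj.symm) h.not_adj
  refine ⟨Function.update L v (L a), fun i => ?_, fun i j hij => ?_⟩
  · rw [labelClass_update h.adj_left.ne (hv i)]
    exact (hc i).extendTo h.adj_or h.adj_left h.adj_right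
  · rw [labelClass_update h.adj_left.ne (hv i), labelClass_update h.adj_left.ne (hv j)]
    exact (ht i j hij).extendTo fun x y hxy => (h.adj_or x y hxy).imp_right (⟨h.adj_right, ·⟩)

lemma notMem_true (h : IsBypass G G' v a b) {L : V → Option (Bool × Fin 3)}
    (hL : IsSunModel G' M' L) (i : Fin 3) : v ∉ labelClass L (true, i) := by
  obtain ⟨j, hj⟩ := exists_ne i
  exact (hL.conn i).not_mem_of_isolated (hL.touches i j hj.symm) h.not_adj

lemma exists_isSunModel (h : IsBypass G G' v a b)
    (hM : ∀ x y, M'.Adj x y → M.Adj x y ∨ M.Adj v b ∧ (x = a ∧ y = b ∨ x = b ∧ y = a))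
    {L : V → Option (Bool × Fin 3)} (hL : IsSunModel G' M' L) : ∃ L, IsSunModel G M L := by
  classical
  have hva := h.adj_left.ne
  have hv := h.notMem_true hL
  have hadj x y (hxy : G'.Adj x y) :
      G.Adj x y ∨ G.Adj v b ∧ (x = a ∧ y = b ∨ x = b ∧ y = a) :=
    (h.adj_or x y hxy).imp_right (⟨h.adj_right, ·⟩)
  refine ⟨Function.update L v (L a), fun i => ?_, fun i j hij => ?_, fun i => ?_⟩
  · rw [labelClass_update hva (hv i)]
    exact (hL.conn i).extendTo h.adj_or h.adj_left h.adj_right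
  · rw [labelClass_update hva (hv i), labelClass_update hva (hv j)]
    exact (hL.touches i j hij).extendTo hadj
  · refine (hL.ear i).imp (fun H j k hij hik hjk => ?_) (fun ⟨hc, ht⟩ => ?_)
    · rw [labelClass_update hva (hv j), labelClass_update hva (hv k)]
      exact (H j k hij hik hjk).extendTo hM
    · obtain ⟨j, hj⟩ := exists_ne i
      have hvi := hc.not_mem_of_isolated (ht j hj.symm) h.not_adj
      rw [labelClass_update hva hvi]
      refine ⟨hc.extendTo h.adj_or h.adj_left h.adj_right, fun j hij => ?_⟩
      rw [labelClass_update hva (hv j)]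
      exact (ht j hij).extendTo hadj

lemma exists_isSunModel_of_adj (h : IsBypass G G' v a b) (hab : G.Adj a b)
    (hM : ∀ x y, M'.Adj x y → M.Adj x y ∨ (x = a ∧ y = b ∨ x = b ∧ y = a))
    {L : V → Option (Bool × Fin 3)} (hL : IsSunModel G' M' L) : ∃ L, IsSunModel G M L := by
  classical
  have hv := h.notMem_true hL
  have hle : G' ≤ G := by
    intro x y hxy
    rcases h.adj_or x y hxy with h | ⟨rfl, rfl⟩ | ⟨rfl, rfl⟩
    exacts [h, hab, hab.symm]
  have hmark : ∀ j k, Touches M' (labelClass L (true, j)) (labelClass L (true, k)) →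
      Touches M (labelClass L (true, j)) (labelClass L (true, k)) ∨
      (L a = some (true, j) ∧ L b = some (true, k) ∨ L b = some (true, j) ∧ L a = some (true, k)) := by
    rintro j k ⟨x, hx, y, hy, hxy⟩
    rcases hM x y hxy with h | ⟨rfl, rfl⟩ | ⟨rfl, rfl⟩
    · exact Or.inl ⟨x, hx, y, hy, h⟩
    · exact Or.inr (Or.inl ⟨hx, hy⟩)
    · exact Or.inr (Or.inr ⟨hx, hy⟩)
  by_cases hsep : ∃ j k : Fin 3, j ≠ k ∧ L a = some (true, j) ∧ L b = some (true, k)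
  · obtain ⟨j, k, hjk, hj, hk⟩ := hsep
    obtain ⟨i, hij, hik, huniq⟩ : ∃ i, i ≠ j ∧ i ≠ k ∧ ∀ l, l ≠ i → l = j ∨ l = k := by
      clear hj hk; revert j k; decide
    have hvf : ∀ l, ConnectedOn G' (labelClass L (false, l)) ∧
        (∀ j, l ≠ j → Touches G' (labelClass L (false, l)) (labelClass L (true, j))) →
        v ∉ labelClass L (false, l) := by
      rintro l ⟨hc, ht⟩
      obtain ⟨m, hm⟩ := exists_ne l
      exact hc.not_mem_of_isolated (ht m hm.symm) h.not_adj
    let F : Bool × Fin 3 → Set V := fun p => if p = (false, i) then {v} else labelClass L p \ {v}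
    have hFt l : F (true, l) = labelClass L (true, l) := by
      simp [F, Set.sdiff_singleton_eq_self (hv l)]
    refine exists_isSunModel_of_sets F ?_ ?_ ?_ ?_
    · intro p q hpq
      have := disjoint_labelClass L hpq
      simp only [F]
      split_ifs with h1 h2 h2
      · exact absurd (h1.trans h2.symm) hpq
      · exact Set.disjoint_sdiff_right
      · exact Set.disjoint_sdiff_left
      · exact this.mono Set.sdiff_subset Set.sdiff_subset
    · intro l
      rw [hFt]
      exact (hL.conn l).mono hle
    · intro l m hlm
      rw [hFt, hFt]
      exact (hL.touches l m hlm).mono hle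
    · intro l
      by_cases hl : l = i
      · subst hl
        right
        simp only [hFt, F, if_true]
        refine ⟨connectedOn_singleton, fun m hm => ?_⟩
        rcases huniq m hm.symm with rfl | rfl
        · exact ⟨v, rfl, a, hj, h.adj_left⟩
        · exact ⟨v, rfl, b, hk, h.adj_right⟩
      · rcases hL.ear l with H | ⟨hc, ht⟩
        · left
          intro m n hlm hln hmn
          rw [hFt, hFt]
          refine (hmark m n (H m n hlm hln hmn)).resolve_right ?_
          rw [hj, hk]
          have := huniq l hl
          simp only [Option.some.injEq, Prod.mk.injEq, true_and]
          rintro (⟨rfl, rfl⟩ | ⟨rfl, rfl⟩) <;> grind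
        · right
          have : F (false, l) = labelClass L (false, l) := by
            simp [F, hl, Set.sdiff_singleton_eq_self (hvf l ⟨hc, ht⟩)]
          rw [this]
          refine ⟨hc.mono hle, fun m hm => ?_⟩
          rw [hFt]
          exact (ht m hm).mono hle
  · refine ⟨L, fun i => (hL.conn i).mono hle, fun i j hij => (hL.touches i j hij).mono hle,
      fun i => (hL.ear i).imp (fun H j k hij hik hjk => ?_)
        (fun ⟨hc, ht⟩ => ⟨hc.mono hle, fun j hij => (ht j hij).mono hle⟩)⟩
    refine (hmark j k (H j k hij hik hjk)).resolve_right ?_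
    rintro (⟨h1, h2⟩ | ⟨h1, h2⟩)
    · exact hsep ⟨j, k, hjk, h1, h2⟩
    · exact hsep ⟨k, j, hjk.symm, h2, h1⟩

lemma connectedOn_diff (h : IsBypass G G' v a b) {w : V} (hva : a ∈ S) (hvb : b ∈ S) (hwv : w ≠ v)
    (hS : ConnectedOn G (S \ {w})) : ConnectedOn G' ((S \ {v}) \ {w}) := by
  have hav := h.adj_left.ne.symm
  have hbv := h.adj_right.ne.symm
  have hab := h.ne
  refine ⟨?_, fun X hX ⟨u, hu⟩ hcl => ?_⟩
  · by_cases haw : a = w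
    · exact ⟨b, ⟨hvb, hbv⟩, fun hb => h.ne (haw.trans hb.symm)⟩
    · exact ⟨a, ⟨hva, hav⟩, haw⟩
  · have key : S \ {w} ⊆ {x | x ∈ X ∨ x = v ∧ (a ∈ X ∨ b ∈ X)} ∩ (S \ {w}) := by
      refine hS.2 _ (fun x hx => hx.2) ⟨u, Or.inl hu, (hX hu).1.1, (hX hu).2⟩ ?_
      rintro x ⟨hx, hxS⟩ y hy hxy
      refine ⟨?_, hy⟩
      by_cases hyv : y = v
      · subst hyv
        have := (h.adj_iff x).1 hxy.symm
        have := hxy.ne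
        simp only [Set.mem_ofPred_eq] at hx ⊢
        grind
      · left
        rcases hx with hx | ⟨rfl, hx⟩
        · exact hcl x hx y ⟨⟨hy.1, hyv⟩, hy.2⟩
            ((h.adj_iff' x y).2 (Or.inl ⟨hxy, (hX hx).1.2, hyv⟩))
        · have hy' : y ∈ (S \ {x}) \ {w} := ⟨⟨hy.1, hyv⟩, hy.2⟩
          rcases (h.adj_iff y).1 hxy with rfl | rfl
          · exact hx.elim id fun hx => hcl _ hx _ hy' ((h.adj_iff' _ _).2 (by simp))
          · exact hx.elim (fun hx => hcl _ hx _ hy' ((h.adj_iff' _ _).2 (by simp))) id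
    intro y hy
    rcases (key ⟨hy.1.1, hy.2⟩).1 with h | ⟨h, -⟩
    · exact h
    · exact absurd h hy.1.2

end IsBypass

end Bypass

section Completion

variable {V : Type} {G M G' M' H H' : SimpleGraph V} {S : Set V} {v a b c : V}

lemma IsBlocked.symm (h : IsBlocked H M a b c) : IsBlocked H M b a c := by
  rcases h with h | ⟨d, hd, h1, h2⟩
  · exact Or.inl h.symm
  · exact Or.inr ⟨d, hd, h2, h1⟩

lemma cliqueFree_four_of_forall (h : ∀ a b c d, H.Adj a b → H.Adj a c → H.Adj a d → H.Adj b c →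
    H.Adj b d → H.Adj c d → False) : H.CliqueFree 4 := by
  by_contra hcon
  obtain ⟨f⟩ := (not_cliqueFree_iff_top_isContained 4).1 hcon
  have key : ∀ i j : Fin 4, i ≠ j → H.Adj (f i) (f j) := fun i j hij => f.toHom.map_adj hij
  exact h (f 0) (f 1) (f 2) (f 3) (key _ _ (by decide)) (key _ _ (by decide)) (key _ _ (by decide))
    (key _ _ (by decide)) (key _ _ (by decide)) (key _ _ (by decide))

/-- `H` is a chordal supergraph of `G` of clique number at most three, supported on `S`, in which
every triangle has an edge that is neither marked in `M` nor contained in a second triangle. -/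
structure IsCompletion (G M H : SimpleGraph V) (S : Set V) : Prop where
  le : G ≤ H
  supp : ∀ x y, H.Adj x y → x ∈ S
  elim : IsEliminable H
  cliqueFree : H.CliqueFree 4
  clear : ∀ a b c, H.Adj a b → H.Adj b c → H.Adj c a →
    IsBlocked H M a b c → IsBlocked H M b c a → IsBlocked H M c a b → False

lemma IsBypass.exists_isCompletion (h : IsBypass G G' v a b) (hH : IsCompletion G' M' H' (S \ {v}))
    (hvS : v ∈ S) (hM : ∀ x y, x ≠ v → y ≠ v → M.Adj x y → M'.Adj x y)
    (hab : M'.Adj a b ∨ ∀ c, H'.Adj a c → H'.Adj b c →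
      ¬ (IsBlocked H' M' a c b ∧ IsBlocked H' M' b c a))
    (hv : ¬ (M.Adj v a ∧ M.Adj v b ∧ (M.Adj a b ∨ ∃ c, H'.Adj a c ∧ H'.Adj b c))) :
    ∃ H, IsCompletion G M H S := by
  have hva := h.adj_left.ne
  have hvb := h.adj_right.ne
  have hne := h.ne
  have hab' : H'.Adj a b := hH.le ((h.adj_iff' a b).2 (by simp))
  have hv' x y (hxy : H'.Adj x y) : x ≠ v ∧ y ≠ v := ⟨(hH.supp x y hxy).2, (hH.supp y x hxy.symm).2⟩
  obtain ⟨H, hHadj⟩ : ∃ H : SimpleGraph V, ∀ x y, H.Adj x y ↔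
      H'.Adj x y ∨ x = v ∧ (y = a ∨ y = b) ∨ y = v ∧ (x = a ∨ x = b) := by
    refine ⟨⟨fun x y => H'.Adj x y ∨ x = v ∧ (y = a ∨ y = b) ∨ y = v ∧ (x = a ∨ x = b), ?_, ?_⟩,
      fun x y => Iff.rfl⟩
    · constructor
      rintro x y (h | h | h)
      exacts [Or.inl h.symm, Or.inr (Or.inr h), Or.inr (Or.inl h)]
    · constructor
      rintro x (h | ⟨rfl, h⟩ | ⟨rfl, h⟩)
      · exact h.ne rfl
      · grind
      · grind
  have hHv x : H.Adj v x ↔ x = a ∨ x = b := by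
    rw [hHadj]
    constructor
    · rintro (h | ⟨-, h⟩ | ⟨-, h⟩)
      · exact absurd rfl (hv' _ _ h).1
      · exact h
      · grind
    · exact fun h => Or.inr (Or.inl ⟨rfl, h⟩)
  have hH' x y (hx : x ≠ v) (hy : y ≠ v) : H.Adj x y ↔ H'.Adj x y := by
    rw [hHadj]; simp [hx, hy]
  have habH : H.Adj a b := (hHadj _ _).2 (Or.inl hab')
  have hvbad : ∀ y z, (y = a ∧ z = b ∨ y = b ∧ z = a) → IsBlocked H M v y z → IsBlocked H M y z v →
      IsBlocked H M z v y → False := by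
    intro y z hyz h1 h2 h3
    have h1' : M.Adj v y := by
      rcases h1 with h1 | ⟨d, hd, hvd, hyd⟩
      · exact h1
      · rw [hHv] at hvd
        have := hyd.ne
        grind
    have h3' : M.Adj v z := by
      rcases h3 with h3 | ⟨d, hd, hzd, hvd⟩
      · exact h3.symm
      · rw [hHv] at hvd
        have := hzd.ne
        grind
    have h2' : M.Adj y z ∨ ∃ c, H'.Adj y c ∧ H'.Adj z c := by
      refine h2.imp id ?_
      rintro ⟨d, hd, hyd, hzd⟩
      exact ⟨d, (hH' _ _ (by grind) hd).1 hyd, (hH' _ _ (by grind) hd).1 hzd⟩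
    rcases hyz with ⟨rfl, rfl⟩ | ⟨rfl, rfl⟩
    · exact hv ⟨h1', h3', h2'⟩
    · exact hv ⟨h3', h1', h2'.imp Adj.symm fun ⟨c, hc⟩ => ⟨c, hc.symm⟩⟩
  have hblk : ∀ p q r, p ≠ v → q ≠ v → H.Adj p q → IsBlocked H M p q r → IsBlocked H' M' p q r ∨
      ((p = a ∧ q = b ∨ p = b ∧ q = a) ∧ ¬ M'.Adj a b) := by
    rintro p q r hp hq hpq (h | ⟨d, hd, hpd, hqd⟩)
    · exact Or.inl (Or.inl (hM p q hp hq h))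
    · by_cases hdv : d = v
      · subst hdv
        have h1 := (hHv _).1 hpd.symm
        have h2 := (hHv _).1 hqd.symm
        have h3 := hpq.ne
        by_cases hM' : M'.Adj a b
        · left; left
          have := hM'.symm
          grind
        · right
          exact ⟨by grind, hM'⟩
      · exact Or.inl (Or.inr ⟨d, hd, (hH' _ _ hp hdv).1 hpd, (hH' _ _ hq hdv).1 hqd⟩)
  refine ⟨H, ⟨fun x y hxy => ?_, fun x y hxy => ?_, fun T hT => ?_, ?_, ?_⟩⟩
  · by_cases hx : x = v
    · subst hx
      exact (hHv y).2 ((h.adj_iff y).1 hxy)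
    · by_cases hy : y = v
      · subst hy
        exact ((hHv x).2 ((h.adj_iff x).1 hxy.symm)).symm
      · exact (hH' _ _ hx hy).2 (hH.le ((h.adj_iff' _ _).2 (Or.inl ⟨hxy, hx, hy⟩)))
  · rcases (hHadj _ _).1 hxy with h | ⟨rfl, -⟩ | ⟨-, rfl | rfl⟩
    · exact (hH.supp _ _ h).1
    · exact hvS
    · exact (hH.supp _ _ hab').1
    · exact (hH.supp _ _ hab'.symm).1
  · by_cases hvT : v ∈ T
    · refine ⟨v, hvT, fun x _ y _ hx hy hxy => ?_⟩
      rw [hHv] at hx hy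
      have := habH.symm
      grind
    · obtain ⟨w, hw, hs⟩ := hH.elim T hT
      have hTv : ∀ x ∈ T, x ≠ v := fun x hx hxv => hvT (hxv ▸ hx)
      refine ⟨w, hw, fun x hx y hy => ?_⟩
      rw [hH' _ _ (hTv w hw) (hTv x hx), hH' _ _ (hTv w hw) (hTv y hy),
        hH' _ _ (hTv x hx) (hTv y hy)]
      exact hs x hx y hy
  · refine cliqueFree_four_of_forall fun p q r s hpq hpr hps hqr hqs hrs => ?_
    have hnv : ∀ p q r s, H.Adj p q → H.Adj p r → H.Adj p s → H.Adj q r → H.Adj q s → H.Adj r s →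
        p ≠ v := by
      rintro p q r s hpq hpr hps hqr hqs hrs rfl
      rw [hHv] at hpq hpr hps
      have := hqr.ne
      have := hqs.ne
      have := hrs.ne
      grind
    have hp := hnv p q r s hpq hpr hps hqr hqs hrs
    have hq := hnv q p r s hpq.symm hqr hqs hpr hps hrs
    have hr := hnv r p q s hpr.symm hqr.symm hrs hpq hps hqs
    have hs := hnv s p q r hps.symm hqs.symm hrs.symm hpq hpr hqr
    rw [hH' _ _ (by assumption) (by assumption)] at hpq hpr hps hqr hqs hrs
    exact not_adj_of_cliqueFree_four hH.cliqueFree hpq hpr hqr hps hqs hrs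
  · intro x y z hxy hyz hzx B1 B2 B3
    by_cases hx : x = v
    · subst hx
      have h1 := (hHv _).1 hxy
      have h2 := (hHv _).1 hzx.symm
      have h3 := hyz.ne
      exact hvbad y z (by grind) B1 B2 B3
    by_cases hy : y = v
    · subst hy
      have h1 := (hHv _).1 hyz
      have h2 := (hHv _).1 hxy.symm
      have h3 := hzx.ne
      exact hvbad z x (by grind) B2 B3 B1
    by_cases hz : z = v
    · subst hz
      have h1 := (hHv _).1 hzx
      have h2 := (hHv _).1 hyz.symm
      have h3 := hxy.ne
      exact hvbad x y (by grind) B3 B1 B2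
    have C1 := hblk x y z hx hy hxy B1
    have C2 := hblk y z x hy hz hyz B2
    have C3 := hblk z x y hz hx hzx B3
    have hxy' := hxy.ne
    have hyz' := hyz.ne
    have hzx' := hzx.ne
    rw [hH' _ _ (by assumption) (by assumption)] at hxy hyz hzx
    have hfin : ∀ p q r, H'.Adj q r → H'.Adj r p → (p = a ∧ q = b ∨ p = b ∧ q = a) →
        ¬ M'.Adj a b → IsBlocked H' M' q r p → IsBlocked H' M' r p q → False := by
      rintro p q r hqr hrp (⟨rfl, rfl⟩ | ⟨rfl, rfl⟩) hM' D2 D3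
      · exact hab.resolve_left hM' r hrp.symm hqr ⟨D3.symm, D2⟩
      · exact hab.resolve_left hM' r hqr hrp.symm ⟨D2, D3.symm⟩
    rcases C1 with C1 | ⟨C1, hM'⟩
    · rcases C2 with C2 | ⟨C2, hM'⟩
      · rcases C3 with C3 | ⟨C3, hM'⟩
        · exact hH.clear x y z hxy hyz hzx C1 C2 C3
        · exact hfin z x y hxy hyz C3 hM' C1 C2
      · exact hfin y z x hzx hxy C2 hM' (C3.resolve_right (by grind)) C1
    · exact hfin x y z hyz hzx C1 hM' (C2.resolve_right (by grind)) (C3.resolve_right (by grind))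

/-- If the edge `ab` is the only clear edge of a triangle `abc`, it can be replaced by an edge from
the new vertex `v` to `c`. -/
lemma IsBypass.exists_isCompletion_of_flip (h : IsBypass G G' v a b)
    (hH : IsCompletion G' M' H' (S \ {v})) (hvS : v ∈ S) (hab : ¬ G.Adj a b)
    (hM : ∀ x y, x ≠ v → y ≠ v → M.Adj x y → M'.Adj x y) (hMa : ¬ M.Adj v a) (hMb : ¬ M.Adj v b)
    (hac : H'.Adj a c) (hbc : H'.Adj b c) (hac' : IsBlocked H' M' a c b)
    (hbc' : IsBlocked H' M' b c a) : ∃ H, IsCompletion G M H S := by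
  have hva := h.adj_left.ne
  have hvb := h.adj_right.ne
  have hne := h.ne
  have hab' : H'.Adj a b := hH.le ((h.adj_iff' a b).2 (by simp))
  have hv' x y (hxy : H'.Adj x y) : x ≠ v ∧ y ≠ v := ⟨(hH.supp x y hxy).2, (hH.supp y x hxy.symm).2⟩
  have hvc := (hv' _ _ hac).2.symm
  have hcuniq : ∀ d, H'.Adj a d → H'.Adj b d → d = c := by
    intro d hd1 hd2
    by_contra hdc
    exact hH.clear a b c hab' hbc hac.symm (Or.inr ⟨d, hdc, hd1, hd2⟩) hbc' hac'.symm
  have hac_ne := hac.ne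
  have hbc_ne := hbc.ne
  obtain ⟨H, hHadj⟩ : ∃ H : SimpleGraph V, ∀ x y, H.Adj x y ↔
      H'.Adj x y ∧ ¬ (x = a ∧ y = b ∨ x = b ∧ y = a) ∨
        x = v ∧ (y = a ∨ y = b ∨ y = c) ∨ y = v ∧ (x = a ∨ x = b ∨ x = c) := by
    refine ⟨⟨fun x y => H'.Adj x y ∧ ¬ (x = a ∧ y = b ∨ x = b ∧ y = a) ∨
        x = v ∧ (y = a ∨ y = b ∨ y = c) ∨ y = v ∧ (x = a ∨ x = b ∨ x = c), ?_, ?_⟩,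
      fun x y => Iff.rfl⟩
    · constructor
      rintro x y (⟨h, h2⟩ | h | h)
      exacts [Or.inl ⟨h.symm, by grind⟩, Or.inr (Or.inr h), Or.inr (Or.inl h)]
    · constructor
      rintro x (⟨h, -⟩ | ⟨rfl, h⟩ | ⟨rfl, h⟩)
      · exact h.ne rfl
      · grind
      · grind
  have hHv x : H.Adj v x ↔ x = a ∨ x = b ∨ x = c := by
    rw [hHadj]
    constructor
    · rintro (h | ⟨-, h⟩ | ⟨-, h⟩)
      · exact absurd rfl (hv' _ _ h.1).1
      · exact h
      · grind
    · exact fun h => Or.inr (Or.inl ⟨rfl, h⟩)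
  have hH' x y (hx : x ≠ v) (hy : y ≠ v) :
      H.Adj x y ↔ H'.Adj x y ∧ ¬ (x = a ∧ y = b ∨ x = b ∧ y = a) := by
    rw [hHadj]; simp [hx, hy]
  have hnab : ¬ H.Adj a b := by rw [hH' _ _ hva.symm hvb.symm]; simp
  have hacH : H.Adj a c := by rw [hH' _ _ hva.symm hvc.symm]; exact ⟨hac, by grind⟩
  have hbcH : H.Adj b c := by rw [hH' _ _ hvb.symm hvc.symm]; exact ⟨hbc, by grind⟩
  refine ⟨H, ⟨fun x y hxy => ?_, fun x y hxy => ?_, fun T hT => ?_, ?_, ?_⟩⟩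
  · by_cases hx : x = v
    · subst hx
      exact (hHv y).2 (by have := (h.adj_iff y).1 hxy; tauto)
    · by_cases hy : y = v
      · subst hy
        exact ((hHv x).2 (by have := (h.adj_iff x).1 hxy.symm; tauto)).symm
      · refine (hH' _ _ hx hy).2 ⟨hH.le ((h.adj_iff' _ _).2 (Or.inl ⟨hxy, hx, hy⟩)), ?_⟩
        rintro (⟨rfl, rfl⟩ | ⟨rfl, rfl⟩)
        exacts [hab hxy, hab hxy.symm]
  · rcases (hHadj _ _).1 hxy with h | ⟨rfl, -⟩ | ⟨-, rfl | rfl | rfl⟩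
    · exact (hH.supp _ _ h.1).1
    · exact hvS
    · exact (hH.supp _ _ hab').1
    · exact (hH.supp _ _ hab'.symm).1
    · exact (hH.supp _ _ hac.symm).1
  · have hnbr : ∀ p q : V, (p = a ∧ q = b ∨ p = b ∧ q = a) → ∀ T₀ : Set V, q ∈ T₀ →
        (∀ x ∈ T, x ≠ v → x ≠ c → x ∈ T₀) →
        (∀ x ∈ T₀, ∀ y ∈ T₀, H'.Adj p x → H'.Adj p y → x ≠ y → H'.Adj x y) →
        ∀ x ∈ T, ∀ y ∈ T, H.Adj p x → H.Adj p y → x ≠ y → H.Adj x y := by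
      intro p q hpq T₀ hq hT₀ hs
      have hsub : ∀ x ∈ T, H.Adj p x → x = c ∨ x = v := by
        intro x hx hpx
        by_contra! hcon
        have hpv : p ≠ v := by grind
        have h1 := (hH' _ _ hpv hcon.2).1 hpx
        have hpq' : H'.Adj p q := by
          have := hab'.symm
          grind
        have h2 := hs x (hT₀ x hx hcon.2 hcon.1) q hq h1.1 hpq' (by grind)
        rcases hpq with ⟨rfl, rfl⟩ | ⟨rfl, rfl⟩
        · exact hcon.1 (hcuniq x h1.1 h2.symm)
        · exact hcon.1 (hcuniq x h2.symm h1.1)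
      intro x hx y hy hpx hpy hxy
      have hvc' : H.Adj v c := (hHv c).2 (by simp)
      rcases hsub x hx hpx with rfl | rfl <;> rcases hsub y hy hpy with rfl | rfl
      exacts [absurd rfl hxy, hvc'.symm, hvc', absurd rfl hxy]
    have hrest : ∀ w, w ≠ v → ¬ (H.Adj w a ∧ a ∈ T ∧ H.Adj w b ∧ b ∈ T) → ∀ T₀ : Set V,
        (∀ x ∈ T, H.Adj w x → x ∈ T₀) → (∀ x ∈ T₀, x ≠ v) →
        (∀ x ∈ T₀, ∀ y ∈ T₀, H'.Adj w x → H'.Adj w y → x ≠ y → H'.Adj x y) →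
        ∀ x ∈ T, ∀ y ∈ T, H.Adj w x → H.Adj w y → x ≠ y → H.Adj x y := by
      intro w hwv hwab T₀ hT₀ hT₀v hs x hx y hy hwx hwy hxy
      have hx0 := hT₀ x hx hwx
      have hy0 := hT₀ y hy hwy
      refine (hH' _ _ (hT₀v x hx0) (hT₀v y hy0)).2 ⟨hs x hx0 y hy0 ((hH' _ _ hwv (hT₀v x hx0)).1 hwx).1
        ((hH' _ _ hwv (hT₀v y hy0)).1 hwy).1 hxy, ?_⟩
      rintro (⟨rfl, rfl⟩ | ⟨rfl, rfl⟩)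
      exacts [hwab ⟨hwx, hx, hwy, hy⟩, hwab ⟨hwy, hy, hwx, hx⟩]
    have hnc : ∀ w, w ≠ v → w ≠ c → ¬ (H.Adj w a ∧ a ∈ T ∧ H.Adj w b ∧ b ∈ T) := by
      rintro w hwv hwc ⟨h1, -, h2, -⟩
      exact hwc (hcuniq w ((hH' _ _ hwv hva.symm).1 h1).1.symm ((hH' _ _ hwv hvb.symm).1 h2).1.symm)
    by_cases hvT : v ∈ T ∧ ¬ (a ∈ T ∧ b ∈ T)
    · refine ⟨v, hvT.1, fun x hx y hy hvx hvy hxy => ?_⟩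
      rw [hHv] at hvx hvy
      have := hacH.symm
      have := hbcH.symm
      grind
    have hne : (T \ {v}).Nonempty := by
      obtain ⟨t, ht⟩ := hT
      by_cases htv : t = v
      · subst htv
        exact ⟨a, by by_contra hcon; exact hvT ⟨ht, fun h => hcon ⟨h.1, hva.symm⟩⟩⟩
      · exact ⟨t, ht, htv⟩
    obtain ⟨w, hw, hs⟩ := hH.elim _ hne
    have hTv : ∀ w, w ≠ v → ¬ H.Adj w v → ∀ x ∈ T, H.Adj w x → x ∈ T \ {v} := by
      rintro w - hwv x hx hwx
      exact ⟨hx, by rintro rfl; exact hwv hwx⟩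
    have hv'' : ∀ x ∈ T \ {v}, x ≠ v := fun x hx => hx.2
    by_cases hwc : w = c ∧ a ∈ T ∧ b ∈ T
    · obtain ⟨rfl, ha, hb⟩ := hwc
      have hcnbr : ∀ x ∈ T, x ≠ v → H'.Adj w x → x = a ∨ x = b := by
        intro x hx hxv hwx
        by_contra! hcon
        have h1 := hs x ⟨hx, hxv⟩ a ⟨ha, hva.symm⟩ hwx hac.symm hcon.1
        have h2 := hs x ⟨hx, hxv⟩ b ⟨hb, hvb.symm⟩ hwx hbc.symm hcon.2
        exact hwx.ne (hcuniq x h1.symm h2.symm).symm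
      obtain ⟨u, hu, hus⟩ := hH.elim ((T \ {v}) \ {w}) ⟨a, ⟨ha, hva.symm⟩, hac_ne⟩
      refine ⟨u, hu.1.1, ?_⟩
      by_cases hua : u = a
      · subst hua
        exact hnbr u b (by simp) ((T \ {v}) \ {w}) ⟨⟨hb, hvb.symm⟩, hbc_ne⟩ (fun x hx h1 h2 => ⟨⟨hx, h1⟩, h2⟩) hus
      by_cases hub : u = b
      · subst hub
        exact hnbr u a (by simp) ((T \ {v}) \ {w}) ⟨⟨ha, hva.symm⟩, hac_ne⟩ (fun x hx h1 h2 => ⟨⟨hx, h1⟩, h2⟩) hus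
      have huv : ¬ H.Adj u v := by
        intro h
        have := (hHv u).1 h.symm
        have : u ≠ w := hu.2
        grind
      refine hrest u hu.1.2 (hnc u hu.1.2 hu.2) _ (fun x hx hux => ?_) (fun x hx => hx.1.2) hus
      refine ⟨hTv u hu.1.2 huv x hx hux, ?_⟩
      rintro rfl
      have := hcnbr u hu.1.1 hu.1.2 ((hH' _ _ hu.1.2 hvc.symm).1 hux).1.symm
      tauto
    · refine ⟨w, hw.1, ?_⟩
      by_cases hvT' : v ∈ T
      · have hab_mem : a ∈ T ∧ b ∈ T := by tauto
        have hwc' : w ≠ c := by tauto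
        by_cases hwa : w = a
        · subst hwa
          exact hnbr w b (by simp) (T \ {v}) ⟨hab_mem.2, hvb.symm⟩ (fun x hx h1 _ => ⟨hx, h1⟩) hs
        by_cases hwb : w = b
        · subst hwb
          exact hnbr w a (by simp) (T \ {v}) ⟨hab_mem.1, hva.symm⟩ (fun x hx h1 _ => ⟨hx, h1⟩) hs
        refine hrest w hw.2 (hnc w hw.2 hwc') _ (hTv w hw.2 fun h => ?_) hv'' hs
        have := (hHv w).1 h.symm
        tauto
      · refine hrest w hw.2 ?_ (T \ {v}) (fun x hx _ => ⟨hx, ?_⟩) hv'' hs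
        · by_cases hwc' : w = c
          · tauto
          · exact hnc w hw.2 hwc'
        · rintro rfl
          exact hvT' hx
  · refine cliqueFree_four_of_forall fun p q r s hpq hpr hps hqr hqs hrs => ?_
    have hnv : ∀ p q r s, H.Adj p q → H.Adj p r → H.Adj p s → H.Adj q r → H.Adj q s → H.Adj r s →
        p ≠ v := by
      rintro p q r s hpq hpr hps hqr hqs hrs rfl
      rw [hHv] at hpq hpr hps
      have := hqr.ne
      have := hqs.ne
      have := hrs.ne
      have := fun h : H.Adj b a => hnab h.symm
      grind
    have hp := hnv p q r s hpq hpr hps hqr hqs hrs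
    have hq := hnv q p r s hpq.symm hqr hqs hpr hps hrs
    have hr := hnv r p q s hpr.symm hqr.symm hrs hpq hps hqs
    have hs := hnv s p q r hps.symm hqs.symm hrs.symm hpq hpr hqr
    rw [hH' _ _ (by assumption) (by assumption)] at hpq hpr hps hqr hqs hrs
    exact not_adj_of_cliqueFree_four hH.cliqueFree hpq.1 hpr.1 hqr.1 hps.1 hqs.1 hrs.1
  · have hvbad : ∀ p, (p = a ∨ p = b) → IsBlocked H M v p c → False := by
      rintro p hp (hvp | ⟨d, hd, hvd, hpd⟩)
      · rcases hp with rfl | rfl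
        exacts [hMa hvp, hMb hvp]
      · rw [hHv] at hvd
        have := hpd.ne
        have := fun h : H.Adj b a => hnab h.symm
        grind
    have hvbad' : ∀ y z, H.Adj v y → H.Adj y z → H.Adj z v → IsBlocked H M v y z →
        IsBlocked H M z v y → False := by
      intro y z hvy hyz hzv B1 B3
      have h1 := (hHv _).1 hvy
      have h2 := (hHv _).1 hzv.symm
      have h3 := hyz.ne
      have h4 := fun h : H.Adj b a => hnab h.symm
      by_cases hzc : z = c
      · subst hzc
        exact hvbad y (by grind) B1
      · by_cases hyc : y = c
        · subst hyc
          exact hvbad z (by grind) B3.symm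
        · grind
    have hblk : ∀ p q r, p ≠ v → q ≠ v → H.Adj p q → H.Adj q r → H.Adj r p →
        IsBlocked H M p q r → IsBlocked H' M' p q r := by
      rintro p q r hp hq hpq hqr hrp (h | ⟨d, hd, hpd, hqd⟩)
      · exact Or.inl (hM p q hp hq h)
      · right
        by_cases hdv : d = v
        · subst hdv
          have h1 := (hHv _).1 hpd.symm
          have h2 := (hHv _).1 hqd.symm
          have h3 := hpq.ne
          have h4 := fun h : H.Adj b a => hnab h.symm
          by_cases ha : p = a ∨ q = a
          · exact ⟨b, by rintro rfl; grind [Adj.symm], by grind [Adj.symm], by grind [Adj.symm]⟩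
          · exact ⟨a, by rintro rfl; grind [Adj.symm], by grind [Adj.symm], by grind [Adj.symm]⟩
        · exact ⟨d, hd, ((hH' _ _ hp hdv).1 hpd).1, ((hH' _ _ hq hdv).1 hqd).1⟩
    intro x y z hxy hyz hzx B1 B2 B3
    by_cases hx : x = v
    · subst hx
      exact hvbad' y z hxy hyz hzx B1 B3
    by_cases hy : y = v
    · subst hy
      exact hvbad' z x hyz hzx hxy B2 B1
    by_cases hz : z = v
    · subst hz
      exact hvbad' x y hzx hxy hyz B3 B2
    exact hH.clear x y z ((hH' _ _ hx hy).1 hxy).1 ((hH' _ _ hy hz).1 hyz).1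
      ((hH' _ _ hz hx).1 hzx).1 (hblk x y z hx hy hxy hyz hzx B1) (hblk y z x hy hz hyz hzx hxy B2)
      (hblk z x y hz hx hzx hxy hyz B3)

end Completion

section Induction

variable {V : Type} {G M G' M' H H' : SimpleGraph V} {S C : Set V} {v a b c : V}

/-- `G` is supported on `S`, has no cut vertex there, and has neither a model of `K₄` nor a
model of the 3-sun relative to the marked edges `M`. -/
structure IsSunFree (G M : SimpleGraph V) (S : Set V) : Prop where
  supp : ∀ x y, G.Adj x y → x ∈ S
  le : M ≤ G
  conn : ∀ w ∈ S, ConnectedOn G (S \ {w})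
  noClique : ¬ HasCliqueModel G
  noSun : ¬ ∃ L, IsSunModel G M L

lemma IsSunFree.bypass (hS : IsSunFree G M S) (h : IsBypass G G' v a b) (hle : M' ≤ G')
    (hsun : ∀ L, IsSunModel G' M' L → ∃ L, IsSunModel G M L) : IsSunFree G' M' (S \ {v}) where
  supp x y hxy := by
    rcases (h.adj_iff' x y).1 hxy with ⟨hxy, hx, -⟩ | ⟨rfl, -⟩ | ⟨rfl, -⟩
    · exact ⟨hS.supp _ _ hxy, hx⟩
    · exact ⟨hS.supp _ _ h.adj_left.symm, h.adj_left.ne'⟩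
    · exact ⟨hS.supp _ _ h.adj_right.symm, h.adj_right.ne'⟩
  le := hle
  conn w hw := h.connectedOn_diff (hS.supp _ _ h.adj_left.symm) (hS.supp _ _ h.adj_right.symm) hw.2
    (hS.conn w hw.1)
  noClique hc := hS.noClique (h.hasCliqueModel hc)
  noSun := fun ⟨L, hL⟩ => hS.noSun (hsun L hL)

lemma exists_isBypass (hab : a ≠ b) (hv : ∀ x, G.Adj v x ↔ x = a ∨ x = b) :
    ∃ G', IsBypass G G' v a b := by
  refine ⟨G.deleteIncidenceSet v ⊔ edge a b, hab, hv, fun x y => ?_⟩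
  rw [sup_adj, deleteIncidenceSet_adj, edge_adj]
  grind

lemma ConnectedOn.touches_singleton (hS : ConnectedOn G S) (hC : C.Nonempty) (hCS : C ⊆ S)
    (ha : a ∈ S) (haC : a ∉ C) (hcl : ∀ x ∈ C, ∀ y ∈ S, y ≠ a → G.Adj x y → y ∈ C) :
    Touches G C {a} := by
  by_contra hcon
  refine haC (hS.2 C hCS hC (fun x hx y hy hxy => hcl x hx y hy ?_ hxy) ha)
  rintro rfl
  exact hcon ⟨x, hx, y, rfl, hxy⟩

lemma IsSunFree.not_marked (hS : IsSunFree G M S) (hab : a ≠ b)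
    (hv : ∀ x, G.Adj v x ↔ x = a ∨ x = b) (hG : G.Adj a b) (ha : M.Adj v a) (hb : M.Adj v b)
    (hc : M.Adj a b ∨ ∃ c ∈ S, c ≠ v ∧ c ≠ a ∧ c ≠ b) : False := by
  have hva := ha.ne
  have hvb := hb.ne
  obtain ⟨P, hP, hPv, hPa, hPb⟩ : ∃ P : Set V, (Touches M {a} {b} ∨
      ConnectedOn G P ∧ Touches G P {a} ∧ Touches G P {b}) ∧ v ∉ P ∧ a ∉ P ∧ b ∉ P := by
    rcases hc with hc | ⟨c, hcS, hcv, hca, hcb⟩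
    · exact ⟨∅, Or.inl ⟨a, rfl, b, rfl, hc⟩, by simp⟩
    · have haS := hS.supp _ _ hG
      have hbS := hS.supp _ _ hG.symm
      obtain ⟨P, hPS, hcP, hPc, hcl⟩ := exists_component G (A := S \ {a, b}) (c := c)
        ⟨hcS, by simp [hca, hcb]⟩
      have haP : a ∉ P := fun h => (hPS h).2 (by simp)
      have hbP : b ∉ P := fun h => (hPS h).2 (by simp)
      have hcl' : ∀ x ∈ P, ∀ y ∈ S, y ≠ a → y ≠ b → G.Adj x y → y ∈ P := by
        intro x hx y hy h1 h2 hxy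
        exact hcl x hx y ⟨hy, by simp [h1, h2]⟩ hxy
      refine ⟨P, Or.inr ⟨hPc, ?_, ?_⟩, fun hvP => ?_, haP, hbP⟩
      · exact (hS.conn b hbS).touches_singleton ⟨c, hcP⟩
          (fun x hx => ⟨(hPS hx).1, fun h => hbP (h ▸ hx)⟩) ⟨haS, hab⟩ haP
          fun x hx y hy h => hcl' x hx y hy.1 h hy.2
      · exact (hS.conn a haS).touches_singleton ⟨c, hcP⟩
          (fun x hx => ⟨(hPS hx).1, fun h => haP (h ▸ hx)⟩) ⟨hbS, hab.symm⟩ hbP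
          fun x hx y hy h => hcl' x hx y hy.1 hy.2 h
      · obtain ⟨u, hu, hvu⟩ := hPc.exists_adj hvP (by rintro rfl; exact hcv hcP)
        rcases (hv u).1 hvu with rfl | rfl
        exacts [haP hu, hbP hu]
  exact hS.noSun (exists_isSunModel_of_two_marks hS.le (A := {a}) (B := {b}) (C := {v}) (P := P)
    connectedOn_singleton connectedOn_singleton connectedOn_singleton (by simpa using hab)
    (by simpa using hva.symm) (by simpa using hvb.symm) (by simpa using hPa) (by simpa using hPb)
    (by simpa using hPv) ⟨a, rfl, v, rfl, ha.symm⟩ ⟨b, rfl, v, rfl, hb.symm⟩ ⟨a, rfl, b, rfl, hG⟩ hP)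

lemma IsSunFree.exists_isCompletion_of_step (hS : IsSunFree G M S) (h : IsBypass G G' v a b)
    (ih : ∀ M', IsSunFree G' M' (S \ {v}) → ∃ H', IsCompletion G' M' H' (S \ {v}))
    (hab : G.Adj a b ∨ ¬ (M.Adj v a ∧ M.Adj v b)) : ∃ H, IsCompletion G M H S := by
  have hvS := hS.supp _ _ h.adj_left
  have hne := h.ne
  by_cases hmark : G.Adj a b ∨ M.Adj v a ∨ M.Adj v b
  · obtain ⟨M', hM'⟩ : ∃ M' : SimpleGraph V, ∀ x y, M'.Adj x y ↔
        M.Adj x y ∧ x ≠ v ∧ y ≠ v ∨ (x = a ∧ y = b ∨ x = b ∧ y = a) := by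
      refine ⟨M.deleteIncidenceSet v ⊔ edge a b, fun x y => ?_⟩
      rw [sup_adj, deleteIncidenceSet_adj, edge_adj]
      grind
    have hM'' x y (hxy : M'.Adj x y) : M.Adj x y ∨ (x = a ∧ y = b ∨ x = b ∧ y = a) :=
      ((hM' x y).1 hxy).imp_left And.left
    obtain ⟨H', hH'⟩ := ih M' <| hS.bypass h
      (fun x y hxy => (h.adj_iff' x y).2 (((hM' x y).1 hxy).imp_left
        fun hxy => ⟨hS.le hxy.1, hxy.2⟩)) fun L hL => by
        by_cases hG : G.Adj a b
        · exact h.exists_isSunModel_of_adj hG hM'' hL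
        · rcases hmark.resolve_left hG with hva | hvb
          · exact h.swap.exists_isSunModel (fun x y hxy => (hM'' x y hxy).imp_right
              fun H => ⟨hva, H.symm⟩) hL
          · exact h.exists_isSunModel (fun x y hxy => (hM'' x y hxy).imp_right
              fun H => ⟨hvb, H⟩) hL
    refine h.exists_isCompletion hH' hvS (fun x y hx hy hxy => (hM' x y).2 (Or.inl ⟨hxy, hx, hy⟩))
      (Or.inl ((hM' a b).2 (by simp))) ?_
    rintro ⟨hva, hvb, hc⟩
    refine hS.not_marked hne h.adj_iff (hab.resolve_right (not_not.2 ⟨hva, hvb⟩)) hva hvb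
      (hc.imp_right ?_)
    rintro ⟨c, hac, hbc⟩
    have := hH'.supp _ _ hac.symm
    exact ⟨c, this.1, this.2, hac.ne', hbc.ne'⟩
  · push Not at hmark
    obtain ⟨hG, hva, hvb⟩ := hmark
    have hM' x y : (M.deleteIncidenceSet v).Adj x y ↔ M.Adj x y ∧ x ≠ v ∧ y ≠ v :=
      deleteIncidenceSet_adj
    obtain ⟨H', hH'⟩ := ih (M.deleteIncidenceSet v) <| hS.bypass h
      (fun x y hxy => (h.adj_iff' x y).2 (Or.inl (((hM' x y).1 hxy).imp_left fun H => hS.le H)))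
      fun L hL => h.exists_isSunModel (fun x y hxy => Or.inl ((hM' x y).1 hxy).1) hL
    by_cases hc : ∃ c, H'.Adj a c ∧ H'.Adj b c ∧
        IsBlocked H' (M.deleteIncidenceSet v) a c b ∧ IsBlocked H' (M.deleteIncidenceSet v) b c a
    · obtain ⟨c, h1, h2, h3, h4⟩ := hc
      exact h.exists_isCompletion_of_flip hH' hvS hG (fun x y hx hy hxy => (hM' x y).2 ⟨hxy, hx, hy⟩)
        hva hvb h1 h2 h3 h4
    · exact h.exists_isCompletion hH' hvS (fun x y hx hy hxy => (hM' x y).2 ⟨hxy, hx, hy⟩)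
        (Or.inr fun c h1 h2 h3 => hc ⟨c, h1, h2, h3⟩) fun h => hva h.1

/-- If `v` has exactly two neighbours `a` and `b`, which are not adjacent, and both edges at `v` are
marked, then `a` has exactly one further neighbour, and the edge joining them is not marked. -/
lemma IsSunFree.exists_adj_iff (hS : IsSunFree G M S) (hab : a ≠ b)
    (hv : ∀ x, G.Adj v x ↔ x = a ∨ x = b) (hG : ¬ G.Adj a b) (ha : M.Adj v a) (hb : M.Adj v b) :
    ∃ c, c ≠ v ∧ (∀ x, G.Adj a x ↔ x = v ∨ x = c) ∧ ¬ M.Adj a c := by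
  have hva := ha.ne
  have hvb := hb.ne
  have haS := hS.supp _ _ (hS.le ha.symm)
  have hbS := hS.supp _ _ (hS.le hb.symm)
  have hvS := hS.supp _ _ (hS.le ha)
  have hB : ConnectedOn G ((S \ {a}) \ {v}) := by
    refine (hS.conn a haS).diff_simplicial ⟨hvS, hva⟩ ?_ fun x hx y hy h1 h2 hxy => ?_
    · intro h
      have : b ∈ S \ {a} := ⟨hbS, hab.symm⟩
      rw [h] at this
      exact hvb this.symm
    · have h3 : x ≠ a := hx.2
      have h4 : y ≠ a := hy.2
      rw [hv] at h1 h2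
      grind
  have hbB : b ∈ (S \ {a}) \ {v} := ⟨⟨hbS, hab.symm⟩, hvb.symm⟩
  obtain ⟨c, hc, hac⟩ := (hS.conn v hvS).exists_adj (v := a) ⟨haS, hva.symm⟩ (by
    intro h
    have : b ∈ S \ {v} := ⟨hbS, hvb.symm⟩
    rw [h] at this
    exact hab this.symm)
  have hcv : c ≠ v := hc.2
  refine ⟨c, hcv, fun x => ⟨fun hax => ?_, ?_⟩, fun hM => hS.noSun ?_⟩
  · by_contra! hcon
    obtain ⟨hxv, hxc⟩ := hcon
    have key : ∀ c c' B, G.Adj a c → c ≠ v → c' ∈ B → B ⊆ ((S \ {a}) \ {v}) \ {c} → G.Adj a c' →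
        b ∈ B → ConnectedOn G B → (∀ x ∈ B, ∀ y ∈ ((S \ {a}) \ {v}) \ {c}, G.Adj x y → y ∈ B) →
        False := by
      intro c c' B hac hcv hc'B hBS hac' hbB hBc hcl
      have haB : a ∉ B := fun h => (hBS h).1.1.2 rfl
      have hvB : v ∉ B := fun h => (hBS h).1.2 rfl
      have hcB : c ∉ B := fun h => (hBS h).2 rfl
      have hcT : Touches G B {c} := hB.touches_singleton hBc.1 (fun x hx => (hBS hx).1)
        ⟨⟨hS.supp _ _ hac.symm, hac.ne'⟩, hcv⟩ hcB
        fun x hx y hy hyc hxy => hcl x hx y ⟨hy, hyc⟩ hxy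
      exact hS.noSun (exists_isSunModel_of_two_marks hS.le (A := {a}) (B := B) (C := {v}) (P := {c})
        connectedOn_singleton hBc connectedOn_singleton (by simpa using haB)
        (by simpa using hva.symm) (by simpa using hvB) (by simpa using hac.ne') (by simpa using hcB)
        (by simpa using hcv) ⟨a, rfl, v, rfl, ha.symm⟩ ⟨b, hbB, v, rfl, hb.symm⟩
        ⟨a, rfl, c', hc'B, hac'⟩
        (Or.inr ⟨connectedOn_singleton, ⟨c, rfl, a, rfl, hac.symm⟩, hcT.symm⟩))
    have hcB : c ∈ (S \ {a}) \ {v} := ⟨⟨hc.1, hac.ne'⟩, hcv⟩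
    have hxB : x ∈ (S \ {a}) \ {v} := ⟨⟨hS.supp _ _ hax.symm, hax.ne'⟩, hxv⟩
    have hbc : b ≠ c := by rintro rfl; exact hG hac
    have hbx : b ≠ x := by rintro rfl; exact hG hax
    obtain ⟨B₁, hB₁, hbB₁, hB₁c, hcl₁⟩ := exists_component G
      (A := ((S \ {a}) \ {v}) \ {c}) (c := b) ⟨hbB, hbc⟩
    by_cases hxB₁ : x ∈ B₁
    · exact key c x B₁ hac hcv hxB₁ hB₁ hax hbB₁ hB₁c hcl₁
    obtain ⟨B₂, hB₂, hbB₂, hB₂c, hcl₂⟩ := exists_component G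
      (A := ((S \ {a}) \ {v}) \ {x}) (c := b) ⟨hbB, hbx⟩
    refine key x c B₂ hax hxv ?_ hB₂ hac hbB₂ hB₂c hcl₂
    have hsub : B₁ ⊆ B₂ ∩ B₁ := hB₁c.2 _ (fun y hy => hy.2) ⟨b, hbB₂, hbB₁⟩ fun y hy z hz hyz =>
      ⟨hcl₂ y hy.1 z ⟨(hB₁ hz).1, by rintro rfl; exact hxB₁ hz⟩ hyz, hz⟩
    obtain ⟨y, hy, z, rfl, hyz⟩ := hB.touches_singleton ⟨b, hbB₁⟩ (fun x hx => (hB₁ hx).1) hcB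
      (fun h => (hB₁ h).2 rfl) fun x hx y hy hyc hxy => hcl₁ x hx y ⟨hy, hyc⟩ hxy
    exact hcl₂ y (hsub hy).1 z ⟨hcB, hxc.symm⟩ hyz
  · rintro (rfl | rfl)
    exacts [hS.le ha.symm, hac]
  · refine exists_isSunModel_of_two_marks hS.le (A := {v}) (B := (S \ {a}) \ {v}) (C := {a})
      (P := ∅) connectedOn_singleton hB connectedOn_singleton (by simp)
      (by simpa using hva) (by simp) (by simp) (by simp)
      (by simp) ⟨v, rfl, a, rfl, ha⟩ ⟨c, ⟨⟨hc.1, hac.ne'⟩, hcv⟩, a, rfl, hM.symm⟩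
      ⟨v, rfl, b, hbB, hS.le hb⟩ (Or.inl ⟨v, rfl, b, hbB, hb⟩)

lemma exists_two_neighbors [Finite V] (hconn : ∀ w ∈ S, ConnectedOn G (S \ {w}))
    (hcard : 2 < S.ncard) (hv : v ∈ S) : ∃ a b, a ≠ b ∧ G.Adj v a ∧ G.Adj v b := by
  have hS : ∀ w, ¬ S ⊆ {v, w} := by
    intro w hsub
    obtain ⟨x, hx, y, hy, z, hz, h⟩ := (Set.two_lt_ncard (Set.toFinite S)).1 hcard
    have h1 := hsub hx
    have h2 := hsub hy
    have h3 := hsub hz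
    simp only [Set.mem_insert_iff, Set.mem_singleton_iff] at h1 h2 h3
    grind
  have hnbr : ∀ w ∈ S, w ≠ v → ∃ u ∈ S, u ≠ w ∧ G.Adj v u := by
    intro w hw hwv
    obtain ⟨u, hu, hvu⟩ := (hconn w hw).exists_adj ⟨hv, hwv.symm⟩ fun h => hS w fun x hx => by
      by_cases hxw : x = w
      · simp [hxw]
      · exact Or.inl (h.subset ⟨hx, hxw⟩)
    exact ⟨u, hu.1, hu.2, hvu⟩
  obtain ⟨w, hw, hwv⟩ : ∃ w ∈ S, w ≠ v := by
    by_contra! hcon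
    exact hS v fun x hx => Or.inl (hcon x hx)
  obtain ⟨a, ha, -, hva⟩ := hnbr w hw hwv
  obtain ⟨b, -, hba, hvb⟩ := hnbr a ha hva.ne'
  exact ⟨a, b, hba.symm, hva, hvb⟩

theorem IsSunFree.exists_isCompletion [Finite V] (hS : IsSunFree G M S) :
    ∃ H, IsCompletion G M H S := by
  induction hn : S.ncard using Nat.strong_induction_on generalizing S G M with
  | _ n ih =>
  subst hn
  by_cases hcard : 2 < S.ncard
  · have step : ∀ v a b, v ∈ S → a ≠ b → (∀ x, G.Adj v x ↔ x = a ∨ x = b) →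
        (G.Adj a b ∨ ¬ (M.Adj v a ∧ M.Adj v b)) → ∃ H, IsCompletion G M H S := by
      intro v a b hvS hab hv hor
      obtain ⟨G', h⟩ := exists_isBypass hab hv
      exact hS.exists_isCompletion_of_step h
        (fun M' hM' => ih _ (Set.ncard_sdiff_singleton_lt_of_mem hvS (Set.toFinite S)) hM' rfl) hor
    have hSne : S.Nonempty := by
      rw [← Set.ncard_pos (Set.toFinite S)]
      lia
    obtain ⟨v, hvS, hdeg⟩ := exists_degree_le_two hS.noClique hS.supp hSne
    obtain ⟨a, b, hab, hva, hvb⟩ := exists_two_neighbors hS.conn hcard hvS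
    have hv : ∀ x, G.Adj v x ↔ x = a ∨ x = b := by
      refine fun x => ⟨fun hx => ?_, ?_⟩
      · have := hdeg x a b hx hva hvb
        grind
      · rintro (rfl | rfl) <;> assumption
    by_cases hor : G.Adj a b ∨ ¬ (M.Adj v a ∧ M.Adj v b)
    · exact step v a b hvS hab hv hor
    · push Not at hor
      obtain ⟨c, hcv, ha, hac⟩ := hS.exists_adj_iff hab hv hor.1 hor.2.1 hor.2.2
      exact step a v c (hS.supp _ _ hva.symm) hcv.symm ha (Or.inr fun h => hac h.2)
  · have h3 : ∀ x y z, x ∈ S → y ∈ S → z ∈ S → x ≠ y → x ≠ z → y ≠ z → False :=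
      fun x y z hx hy hz h1 h2 h3 => hcard
        ((Set.two_lt_ncard (Set.toFinite S)).2 ⟨x, hx, y, hy, z, hz, h1, h2, h3⟩)
    refine ⟨G, le_rfl, hS.supp, ?_, ?_, ?_⟩
    · rintro T ⟨t, ht⟩
      refine ⟨t, ht, fun x _ y _ hx hy hxy => ?_⟩
      exact (h3 t x y (hS.supp _ _ hx) (hS.supp _ _ hx.symm) (hS.supp _ _ hy.symm) hx.ne hy.ne
        hxy).elim
    · refine cliqueFree_four_of_forall fun p q r s hpq hpr _ hqr _ _ => ?_
      exact h3 p q r (hS.supp _ _ hpq) (hS.supp _ _ hqr) (hS.supp _ _ hpr.symm) hpq.ne hpr.ne hqr.ne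
    · intro p q r hpq hqr hrp _ _ _
      exact h3 p q r (hS.supp _ _ hpq) (hS.supp _ _ hqr) (hS.supp _ _ hrp) hpq.ne hrp.ne' hqr.ne

end Induction

section StronglyChordal

variable {V : Type} {H : SimpleGraph V}

lemma IsStronglyChordal.not_isBlocked (hH : IsStronglyChordal H) (hfree : H.CliqueFree 4)
    {a b c : V} (hab : H.Adj a b) (hbc : H.Adj b c) (hca : H.Adj c a) (h1 : IsBlocked H ⊥ a b c)
    (h2 : IsBlocked H ⊥ b c a) (h3 : IsBlocked H ⊥ c a b) : False := by
  obtain ⟨d, hdc, had, hbd⟩ := h1.resolve_left (by simp)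
  obtain ⟨e, hea, hbe, hce⟩ := h2.resolve_left (by simp)
  obtain ⟨f, hfb, hcf, haf⟩ := h3.resolve_left (by simp)
  have hcd : ¬ H.Adj c d := not_adj_of_cliqueFree_four hfree hab hca.symm hbc had hbd
  have hae : ¬ H.Adj a e := not_adj_of_cliqueFree_four hfree hbc hab.symm hca hbe hce
  have hbf : ¬ H.Adj b f := not_adj_of_cliqueFree_four hfree hca hbc.symm hab hcf haf
  have hde : d ≠ e := fun h => hcd (h ▸ hce)
  have hdf : d ≠ f := fun h => hcd (h ▸ hcf)
  have hef : e ≠ f := fun h => hae (h ▸ haf)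
  have hadj : ∀ i : Fin 6, H.Adj ((![a, d, b, e, c, f] : Fin 6 → V) i) (![a, d, b, e, c, f] (i + 1)) := by
    intro i
    fin_cases i
    exacts [had, hbd.symm, hbe, hce.symm, hcf, haf.symm]
  have hinj : Function.Injective (![a, d, b, e, c, f] : Fin 6 → V) := by
    have := hab.ne
    have := hbc.ne
    have := hca.ne
    have := had.ne
    have := hbd.ne
    have := hbe.ne
    have := hce.ne
    have := hcf.ne
    have := haf.ne
    intro i j hij
    fin_cases i <;> fin_cases j <;> first | rfl | (exfalso; simp at hij; grind)
  obtain ⟨i, k, -, hk3, hk6, hik⟩ := hH.2 6 le_rfl (by decide) ![a, d, b, e, c, f] hinj hadj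
  obtain rfl : k = 3 := by lia
  have key : ∀ i : Fin 6, ¬ H.Adj ((![a, d, b, e, c, f] : Fin 6 → V) i)
      (![a, d, b, e, c, f] (i + 3)) := by
    intro i
    fin_cases i
    exacts [hae, fun h => hcd h.symm, hbf, fun h => hae h.symm, hcd, fun h => hbf h.symm]
  exact key i hik

lemma disjoint_image_Icc {g : ℕ → V} {s n : ℕ}
    (hinj : ∀ i j, s < i → i ≤ s + n → s < j → j ≤ s + n → g i = g j → i = j) {i j k l : ℕ}
    (hi : s < i) (hj : j ≤ s + n) (hk : s < k) (hl : l ≤ s + n) (h : j < k ∨ l < i) :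
    Disjoint (g '' Set.Icc i j) (g '' Set.Icc k l) := by
  rw [Set.disjoint_left]
  rintro x ⟨p, hp, rfl⟩ ⟨q, hq, hpq⟩
  rw [Set.mem_Icc] at hp hq
  have := hinj q p (by lia) (by lia) (by lia) (by lia) hpq
  lia

lemma touches_image_Icc {g : ℕ → V} {i j k l p q : ℕ} (hp : p ∈ Set.Icc i j) (hq : q ∈ Set.Icc k l)
    (h : H.Adj (g p) (g q)) : Touches H (g '' Set.Icc i j) (g '' Set.Icc k l) :=
  ⟨_, ⟨p, hp, rfl⟩, _, ⟨q, hq, rfl⟩, h⟩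

lemma IsEliminable.isStronglyChordal [Finite V] (hH : IsEliminable H) (hfree : H.CliqueFree 4)
    (hclear : ∀ a b c, H.Adj a b → H.Adj b c → H.Adj c a → IsBlocked H ⊥ a b c →
      IsBlocked H ⊥ b c a → IsBlocked H ⊥ c a b → False) : IsStronglyChordal H := by
  refine ⟨hH.isChordal, fun n hn hn2 f hf hadj => ?_⟩
  by_contra! hodd
  have : NeZero n := ⟨by lia⟩
  obtain ⟨g, hg⟩ : ∃ g : ℕ → V, ∀ k : ℕ, g k = f k := ⟨fun k => f k, fun _ => rfl⟩
  have hgadj : ∀ k, H.Adj (g k) (g (k + 1)) := fun k => by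
    simpa [hg] using hadj k
  have hgper : ∀ k, g (k + n) = g k := fun k => by simp [hg]
  have hginj : ∀ s i j, s < i → i ≤ s + n → s < j → j ≤ s + n → g i = g j → i = j := by
    intro s i j hi hi' hj hj' hij
    rw [hg, hg] at hij
    have h := (ZMod.natCast_eq_natCast_iff i j n).1 (hf hij)
    rcases le_total i j with hle | hle
    · obtain ⟨t, ht⟩ := (Nat.modEq_iff_dvd' hle).1 h
      have : t = 0 := by
        by_contra ht0
        have : n * 1 ≤ n * t := Nat.mul_le_mul_left n (by lia)
        lia
      subst this
      lia
    · obtain ⟨t, ht⟩ := (Nat.modEq_iff_dvd' hle).1 h.symm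
      have : t = 0 := by
        by_contra ht0
        have : n * 1 ≤ n * t := Nat.mul_le_mul_left n (by lia)
        lia
      subst this
      lia
  have hgodd : ∀ k d, Odd d → 3 ≤ d → d + 3 ≤ n → ¬ H.Adj (g k) (g (k + d)) := by
    intro k d h1 h2 h3
    simpa [hg] using hodd k d h1 h2 h3
  have hE : ∀ k, H.Adj (g k) (g (k + 2)) ∨ H.Adj (g (k + 1)) (g (k + 3)) := by
    intro k
    obtain ⟨d, ⟨m, hm, rfl⟩, h1, h2⟩ := hH.exists_common_neighbor (hgadj (k + 1))
      (T := g '' Set.Icc (k + 2) (k + 1 + n)) ⟨k + 1 + n, ⟨by lia, le_rfl⟩, hgper _⟩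
      ⟨k + 2, ⟨by lia, by lia⟩, rfl⟩ (connectedOn_image_Icc (by lia) fun i hi hi' => by
        rw [deleteEdges_adj]
        refine ⟨hgadj i, fun h => ?_⟩
        rcases Sym2.eq_iff.1 h with ⟨h, h'⟩ | ⟨h, h'⟩
        · have := hginj k i (k + 1) (by lia) (by lia) (by lia) (by lia) h
          lia
        · have := hginj (k + 1) i (k + 2) (by lia) (by lia) (by lia) (by lia) h
          rw [← hgper (k + 1)] at h'
          have := hginj (k + 1) (i + 1) (k + 1 + n) (by lia) (by lia) (by lia) (by lia) h'
          lia)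
    obtain ⟨hm1, hm2⟩ := hm
    obtain ⟨m, rfl⟩ : ∃ t, m = k + 1 + t := ⟨m - (k + 1), by lia⟩
    have hm3 : m ≠ n := by
      rintro rfl
      rw [hgper] at h1
      exact h1.ne rfl
    have hm4 : m ≠ 1 := by
      rintro rfl
      exact h2.ne rfl
    rcases Nat.even_or_odd m with he | ho
    · right
      by_cases hm5 : m = 2
      · subst hm5; exact h1
      · have := hgodd (k + 2) (m - 1) (by grind) (by grind) (by grind)
        rw [show k + 2 + (m - 1) = k + 1 + m by lia] at this
        exact absurd h2 this
    · left
      by_cases hm5 : m = n - 1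
      · subst hm5
        rw [show k + 1 + (n - 1) = k + n by lia, hgper] at h2
        exact h2.symm
      · exact absurd h1 (hgodd (k + 1) m ho (by grind) (by grind))
  have hconn : ∀ i j, i ≤ j → ConnectedOn H (g '' Set.Icc i j) := fun i j hij =>
    connectedOn_image_Icc hij fun k _ _ => hgadj k
  have hE' : ∀ k, H.Adj (g k) (g (k + 2)) → ¬ H.Adj (g (k + 1)) (g (k + 3)) := by
    intro k h1 h2
    refine hH.not_hasCliqueModel hfree ?_
    have hd {i j p q : ℕ} := disjoint_image_Icc (hginj k) (i := i) (j := j) (k := p) (l := q)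
    exact hasCliqueModel_of_sets (hconn (k + 1) (k + 1) le_rfl) (hconn (k + 2) (k + 2) le_rfl)
      (hconn (k + 3) (k + 3) le_rfl) (hconn (k + 4) (k + n) (by lia))
      (hd (by lia) (by lia) (by lia) (by lia) (by lia))
      (hd (by lia) (by lia) (by lia) (by lia) (by lia))
      (hd (by lia) (by lia) (by lia) (by lia) (by lia))
      (hd (by lia) (by lia) (by lia) (by lia) (by lia))
      (hd (by lia) (by lia) (by lia) (by lia) (by lia))
      (hd (by lia) (by lia) (by lia) (by lia) (by lia))
      (touches_image_Icc (p := k + 1) (q := k + 2) (by simp) (by simp) (hgadj _))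
      (touches_image_Icc (p := k + 1) (q := k + 3) (by simp) (by simp) h2)
      (touches_image_Icc (p := k + 1) (q := k + n) (by simp) ⟨by lia, by lia⟩
        (by rw [hgper]; exact (hgadj _).symm))
      (touches_image_Icc (p := k + 2) (q := k + 3) (by simp) (by simp) (hgadj _))
      (touches_image_Icc (p := k + 2) (q := k + n) (by simp) ⟨by lia, by lia⟩
        (by rw [hgper]; exact h1.symm))
      (touches_image_Icc (p := k + 3) (q := k + 4) (by simp) ⟨by lia, by lia⟩ (hgadj _))
  have hE2 : ∀ k, H.Adj (g k) (g (k + 2)) → H.Adj (g (k + 2)) (g (k + 4)) := fun k h =>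
    (hE (k + 1)).resolve_left (hE' k h)
  obtain ⟨s, hs⟩ : ∃ s, H.Adj (g s) (g (s + 2)) := (hE 0).elim (fun h => ⟨0, h⟩) fun h => ⟨1, h⟩
  have hs2 := hE2 s hs
  have hs4 := hE2 (s + 2) hs2
  let lo : Bool × Fin 3 → ℕ := fun p => bif p.1 then ![s + 6, s + 2, s + 4] p.2
    else ![s + 3, s + 5, s + 1] p.2
  let hi : Bool × Fin 3 → ℕ := fun p => bif p.1 then ![s + n, s + 2, s + 4] p.2
    else ![s + 3, s + 5, s + 1] p.2
  have hlohi : ∀ p, lo p ≤ hi p ∧ s < lo p ∧ hi p ≤ s + n := by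
    rintro ⟨b, i⟩
    cases b <;> fin_cases i <;> simp [lo, hi] <;> lia
  have htouch : ∀ p q : Bool × Fin 3, ∀ k l : ℕ, lo p ≤ k → k ≤ hi p → lo q ≤ l → l ≤ hi q →
      H.Adj (g k) (g l) →
      Touches H (g '' Set.Icc (lo p) (hi p)) (g '' Set.Icc (lo q) (hi q)) :=
    fun p q k l h1 h2 h3 h4 h => touches_image_Icc ⟨h1, h2⟩ ⟨h3, h4⟩ h
  obtain ⟨L, hL⟩ := exists_isSunModel_of_sets (G := H) (M := ⊥)
    (fun p => g '' Set.Icc (lo p) (hi p)) (fun p q hpq => by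
      refine disjoint_image_Icc (hginj s) (hlohi p).2.1 (hlohi p).2.2 (hlohi q).2.1 (hlohi q).2.2 ?_
      obtain ⟨b, i⟩ := p
      obtain ⟨b', i'⟩ := q
      cases b <;> cases b' <;> fin_cases i <;> fin_cases i' <;> simp [lo, hi] at hpq ⊢)
    (fun i => hconn _ _ (hlohi _).1) (by
      have h01 := htouch (true, 0) (true, 1) (s + n) (s + 2) (by simp [lo]; lia) (by simp [hi])
        (by simp [lo]) (by simp [hi]) (by rw [hgper]; exact hs)
      have h02 := htouch (true, 0) (true, 2) (s + 6) (s + 4) (by simp [lo]) (by simp [hi]; lia)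
        (by simp [lo]) (by simp [hi]) hs4.symm
      have h12 := htouch (true, 1) (true, 2) (s + 2) (s + 4) (by simp [lo]) (by simp [hi])
        (by simp [lo]) (by simp [hi]) hs2
      intro i j hij
      fin_cases i <;> fin_cases j <;>
        first | exact absurd rfl hij | assumption | exact Touches.symm (by assumption))
    (by
      have h01 := htouch (false, 0) (true, 1) (s + 3) (s + 2) (by simp [lo]) (by simp [hi])
        (by simp [lo]) (by simp [hi]) (hgadj _).symm
      have h02 := htouch (false, 0) (true, 2) (s + 3) (s + 4) (by simp [lo]) (by simp [hi])
        (by simp [lo]) (by simp [hi]) (hgadj _)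
      have h10 := htouch (false, 1) (true, 0) (s + 5) (s + 6) (by simp [lo]) (by simp [hi])
        (by simp [lo]) (by simp [hi]; lia) (hgadj _)
      have h12 := htouch (false, 1) (true, 2) (s + 5) (s + 4) (by simp [lo]) (by simp [hi])
        (by simp [lo]) (by simp [hi]) (hgadj _).symm
      have h20 := htouch (false, 2) (true, 0) (s + 1) (s + n) (by simp [lo]) (by simp [hi])
        (by simp [lo]; lia) (by simp [hi]) (by rw [hgper]; exact (hgadj _).symm)
      have h21 := htouch (false, 2) (true, 1) (s + 1) (s + 2) (by simp [lo]) (by simp [hi])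
        (by simp [lo]) (by simp [hi]) (hgadj _)
      intro i
      refine Or.inr ⟨hconn _ _ (hlohi _).1, fun j hij => ?_⟩
      fin_cases i <;> fin_cases j <;> first | exact absurd rfl hij | assumption)
  obtain ⟨a, b, c, -, -, -, hab, hbc, hca, h1, h2, h3⟩ := hH.exists_blocked hfree bot_le hL
  exact hclear a b c hab hbc hca h1 h2 h3

end StronglyChordal

section Minors

variable {V : Type} {G H : SimpleGraph V}

lemma isMinorOf_K4_iff : IsMinorOf K4 G ↔ HasCliqueModel G := by
  constructor
  · rintro ⟨f, -, hc, hd, ht⟩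
    obtain ⟨L, hL⟩ := exists_labelling f fun i j hij => hd hij
    refine ⟨L, fun i => ?_, fun i j hij => ?_⟩
    · rw [hL, connectedOn_iff_connected]
      exact hc i
    · rw [hL, hL]
      exact ht (by simpa [K4] using hij)
  · rintro ⟨L, hc, ht⟩
    exact ⟨labelClass L, fun i => (hc i).1, fun i => connectedOn_iff_connected.1 (hc i),
      fun i j hij => disjoint_labelClass L hij, fun i j hij => ht i j hij.ne⟩

lemma isMinorOf_S3_iff : IsMinorOf S3 G ↔ ∃ L, IsSunModel G ⊥ L := by
  constructor
  · rintro ⟨f, -, hc, hd, ht⟩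
    have ht' : ∀ w w', S3.Adj w w' → Touches G (f w) (f w') := fun w w' h => ht h
    have hc' : ∀ w, ConnectedOn G (f w) := fun w => connectedOn_iff_connected.2 (hc w)
    refine exists_isSunModel_of_sets
      (fun p => f (bif p.1 then ![1, 3, 5] p.2 else ![4, 0, 2] p.2)) (fun p q hpq => hd ?_)
      (fun i => hc' _) (fun i j hij => ht' _ _ ?_)
      (fun i => Or.inr ⟨hc' _, fun j hij => ht' _ _ ?_⟩)
    · revert p q; decide
    · rw [S3, fromRel_adj]
      revert i j; decide
    · rw [S3, fromRel_adj]
      revert i j; decide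
  · rintro ⟨L, hL⟩
    have hear : ∀ i, ConnectedOn G (labelClass L (false, i)) ∧
        ∀ j, i ≠ j → Touches G (labelClass L (false, i)) (labelClass L (true, j)) := by
      intro i
      refine (hL.ear i).resolve_left fun h => ?_
      obtain ⟨j, k, h1, h2, h3⟩ : ∃ j k, i ≠ j ∧ i ≠ k ∧ j ≠ k := by
        clear h; revert i; decide
      obtain ⟨x, -, y, -, hxy⟩ := h j k h1 h2 h3
      exact hxy
    let e : Fin 6 → Bool × Fin 3 :=
      ![(false, 1), (true, 0), (false, 2), (true, 1), (false, 0), (true, 2)]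
    have hconn : ∀ p, ConnectedOn G (labelClass L p) := by
      rintro ⟨b, i⟩
      cases b
      exacts [(hear i).1, hL.conn i]
    refine ⟨fun w => labelClass L (e w), fun w => (hconn _).1,
      fun w => connectedOn_iff_connected.1 (hconn _),
      fun w w' h => disjoint_labelClass L ?_, fun w w' h => ?_⟩
    · revert w w'; decide
    · have key : ∀ w w', S3.Adj w w' → (e w).2 ≠ (e w').2 ∧ ((e w).1 = true ∨ (e w').1 = true) := by
        simp only [S3, fromRel_adj]
        decide
      obtain ⟨h1, h2⟩ := key w w' h
      change Touches G (labelClass L (e w)) (labelClass L (e w'))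
      generalize e w = p at h1 h2 ⊢
      generalize e w' = q at h1 h2 ⊢
      obtain ⟨b, i⟩ := p
      obtain ⟨b', i'⟩ := q
      cases b <;> cases b'
      · simp at h2
      · exact (hear i).2 i' h1
      · exact ((hear i').2 i h1.symm).symm
      · exact hL.touches i i' h1

lemma HasCliqueModel.mono (hGH : G ≤ H) (h : HasCliqueModel G) : HasCliqueModel H := by
  obtain ⟨L, hc, ht⟩ := h
  exact ⟨L, fun i => (hc i).mono hGH, fun i j hij => (ht i j hij).mono hGH⟩

lemma IsSunModel.mono {M : SimpleGraph V} {L : V → Option (Bool × Fin 3)} (hGH : G ≤ H)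
    (h : IsSunModel G M L) : IsSunModel H M L where
  conn i := (h.conn i).mono hGH
  touches i j hij := (h.touches i j hij).mono hGH
  ear i := (h.ear i).imp_right fun ⟨hc, ht⟩ => ⟨hc.mono hGH, fun j hij => (ht j hij).mono hGH⟩

lemma TwoConnected.connectedOn (hG : TwoConnected G) (w : V) :
    ConnectedOn G (Set.univ \ {w}) := by
  have : Set.univ \ {w} = {x | x ≠ w} := by ext; simp
  rw [this, connectedOn_iff_connected]
  exact hG.2 w

lemma TwoConnected.not_cliqueFree_three [Finite V] (hG : TwoConnected G) (hGH : G ≤ H)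
    (hH : IsEliminable H) : ¬ H.CliqueFree 3 := by
  classical
  intro hfree
  have : Nonempty V := (Nat.card_pos_iff.1 (by have := hG.1; lia)).1
  obtain ⟨v, -, hs⟩ := hH Set.univ Set.univ_nonempty
  obtain ⟨a, b, hab, hva, hvb⟩ := exists_two_neighbors (S := Set.univ)
    (fun w _ => hG.connectedOn w) (by rw [Set.ncard_univ]; exact hG.1) (Set.mem_univ v)
  exact hfree _ (is3Clique_iff.2 ⟨v, a, b, hGH hva, hGH hvb,
    hs a trivial b trivial (hGH hva) (hGH hvb) hab, rfl⟩)

end Minors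

/-- A 2-connected finite simple graph has strongly chordal treewidth equal to two
iff it has no minor isomorphic to `K₄` or to `S₃`. -/
theorem statement10 {V : Type} [Fintype V] (G : SimpleGraph V) (hG : TwoConnected G) :
    sctw G = 2 ↔ (¬ IsMinorOf K4 G ∧ ¬ IsMinorOf S3 G) := by
  rw [isMinorOf_K4_iff, isMinorOf_S3_iff]
  constructor
  · intro h
    have hne : {k | ∃ H : SimpleGraph V, G ≤ H ∧ IsStronglyChordal H ∧
        H.CliqueFree (k + 2)}.Nonempty := by
      by_contra hne
      rw [Set.not_nonempty_iff_eq_empty] at hne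
      rw [sctw, hne, Nat.sInf_empty] at h
      exact absurd h (by decide)
    obtain ⟨H, hGH, hH, hfree⟩ := Nat.sInf_mem hne
    change H.CliqueFree (sctw G + 2) at hfree
    rw [h] at hfree
    have helim := hH.1.isEliminable
    refine ⟨fun hc => helim.not_hasCliqueModel hfree (hc.mono hGH), fun ⟨L, hL⟩ => ?_⟩
    obtain ⟨a, b, c, -, -, -, hab, hbc, hca, h1, h2, h3⟩ :=
      helim.exists_blocked hfree bot_le (hL.mono hGH)
    exact hH.not_isBlocked hfree hab hbc hca h1 h2 h3
  · rintro ⟨hK, hS⟩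
    have hsun : IsSunFree G ⊥ Set.univ :=
      ⟨fun _ _ _ => trivial, bot_le, fun w _ => hG.connectedOn w, hK, hS⟩
    obtain ⟨H, hH⟩ := hsun.exists_isCompletion
    have hmem : 2 ∈ {k | ∃ H : SimpleGraph V, G ≤ H ∧ IsStronglyChordal H ∧
        H.CliqueFree (k + 2)} :=
      ⟨H, hH.le, hH.elim.isStronglyChordal hH.cliqueFree hH.clear, hH.cliqueFree⟩
    refine le_antisymm (Nat.sInf_le hmem) (le_csInf ⟨2, hmem⟩ ?_)
    rintro k ⟨H', hle, hsc, hfree⟩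
    by_contra! hk
    exact hG.not_cliqueFree_three hle hsc.1.isEliminable (hfree.mono (by lia))
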